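/- For every integer r ≥ 5 and every ε > 0, there exist δ > 0 and n₀ such that for all integers n ≥ n₀ the following holds: if A ⊆ [n] satisfies g(A, r) ≥ r^{n/2 - δn}, then either |A △ O| ≤ εn or |A △ I₀| ≤ εn, where O = {1, 3, 5, ..., 2⌈n/2⌉ - 1} is the set of odd numbers in [n] and I₀ = [⌊n/2⌋ + 1, n]. -/

import Mathlib

open Finset

/-- The number of rainbow sum-free `r`-colorings of a finite set `A` of positive
integers. -/
noncomputable def numRSF (r : ℕ) (A : Finset ℕ) : ℕ :=
  Nat.card {f : ↥A → Fin r //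
    ∀ x y z : ↥A, (x : ℕ) + (y : ℕ) = (z : ℕ) →
      ¬(f x ≠ f y ∧ f x ≠ f z ∧ f y ≠ f z)}

/-- Double counting: if a nonnegative weight on `s` is at most `M` everywhere, then
the total weight is at most `M` times the number of points of weight at least `b`,
plus `b` times the number of all points. -/
lemma sum_le_heavy_add_light {α : Type*} (s : Finset α) (w : α → ℕ) (M b : ℝ)
    (hb : 0 ≤ b) (hM : ∀ v ∈ s, (w v : ℝ) ≤ M) :
    ∑ v ∈ s, (w v : ℝ) ≤ M * (s.filter (fun v => b ≤ w v)).card + b * s.card := by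
  classical
  rw [← Finset.sum_filter_add_sum_filter_not s (fun v => b ≤ (w v : ℝ))]
  refine add_le_add ?_ ?_
  · refine (Finset.sum_le_card_nsmul _ _ M fun v hv => hM v (mem_filter.1 hv).1).trans ?_
    rw [nsmul_eq_mul, mul_comm]
  · refine (Finset.sum_le_card_nsmul _ _ b fun v hv => ?_).trans ?_
    · exact (not_le.1 (mem_filter.1 hv).2).le
    · rw [nsmul_eq_mul, mul_comm]
      exact mul_le_mul_of_nonneg_left (by exact_mod_cast card_filter_le _ _) hb

lemma card_filter_product_eq_sum {α β : Type*} (s : Finset α) (t : Finset β)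
    (p : α → β → Prop) [∀ a, DecidablePred (p a)] [DecidablePred fun x : α × β => p x.1 x.2] :
    ((s ×ˢ t).filter (fun x => p x.1 x.2)).card = ∑ a ∈ s, (t.filter (p a)).card := by
  classical
  simp only [card_filter]
  rw [Finset.sum_product]
  refine sum_congr rfl fun a _ => sum_congr rfl fun b _ => ?_
  split_ifs <;> rfl

open Classical in
/-- Container lemma for graphs with `β N Δ` edges and maximum degree `Δ`. -/
lemma exists_graph_containers {α : Type*} (N : ℕ) (G : α → α → Prop)
    (hG : ∀ u v, G u v → G v u) (Δ β : ℝ) (hΔ : 0 < Δ) (hβ : 0 < β) (C : Finset α)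
    (hC : C.card ≤ N) (hdeg : ∀ v ∈ C, ((C.filter (G v)).card : ℝ) ≤ Δ)
    (he : β * N * Δ ≤ ((C ×ˢ C).filter (fun p => G p.1 p.2)).card) (t : ℕ) :
    ∀ C' ⊆ C, (C'.card : ℝ) ≤ C.card - β / 4 * N + t * (β / 4 * Δ) →
      ∃ F : Finset (Finset α), F.card ≤ (N + 1) ^ t ∧
        (∀ D ∈ F, (D.card : ℝ) ≤ C.card - β / 4 * N) ∧
        ∀ I ⊆ C', (∀ u ∈ I, ∀ v ∈ I, ¬ G u v) → ∃ D ∈ F, I ⊆ D := by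
  induction t with
  | zero =>
    intro C' hC' h
    exact ⟨{C'}, by simp, by simpa using h, fun I hI _ => ⟨C', by simp, hI⟩⟩
  | succ t ih =>
    intro C' hC' h
    by_cases hsmall : (C'.card : ℝ) ≤ C.card - β / 4 * N
    · exact ⟨{C'}, by simpa using Nat.one_le_pow _ _ (by omega), by simpa using hsmall,
        fun I hI _ => ⟨C', by simp, hI⟩⟩
    push Not at hsmall
    set w : α → ℕ := fun v => (C'.filter (G v)).card with hw
    set D := C'.filter (fun v => β / 4 * Δ ≤ w v) with hD
    have hwle : ∀ v ∈ C', (w v : ℝ) ≤ Δ := fun v hv =>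
      le_trans (by exact_mod_cast card_le_card (filter_subset_filter _ hC')) (hdeg v (hC' hv))
    have hsd : ((C \ C').card : ℝ) ≤ β / 4 * N := by
      have := card_sdiff_add_card_eq_card hC'
      have : ((C \ C').card : ℝ) + C'.card = C.card := by exact_mod_cast this
      linarith
    have hedge : β / 2 * N * Δ ≤ ∑ v ∈ C', (w v : ℝ) := by
      have hsub : (C ×ˢ C).filter (fun p => G p.1 p.2) ⊆
          ((C' ×ˢ C').filter (fun p => G p.1 p.2)) ∪
          (((C \ C') ×ˢ C).filter (fun p => G p.1 p.2) ∪
            (((C \ C') ×ˢ C).filter (fun p => G p.1 p.2)).image Prod.swap) := by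
        rintro ⟨u, v⟩ huv
        simp only [mem_filter, mem_product, mem_union, mem_image, mem_sdiff, Prod.exists,
          Prod.swap_prod_mk, Prod.mk.injEq] at huv ⊢
        by_cases hu : u ∈ C'
        · by_cases hv : v ∈ C'
          · exact Or.inl ⟨⟨hu, hv⟩, huv.2⟩
          · exact Or.inr (Or.inr ⟨v, u, ⟨⟨⟨huv.1.2, hv⟩, huv.1.1⟩, hG _ _ huv.2⟩, rfl, rfl⟩)
        · exact Or.inr (Or.inl ⟨⟨⟨huv.1.1, hu⟩, huv.1.2⟩, huv.2⟩)
      have hrem : ((((C \ C') ×ˢ C).filter (fun p => G p.1 p.2)).card : ℝ) ≤ β / 4 * N * Δ := by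
        rw [card_filter_product_eq_sum, Nat.cast_sum]
        refine (Finset.sum_le_card_nsmul _ _ Δ fun v hv => hdeg v (mem_sdiff.1 hv).1).trans ?_
        rw [nsmul_eq_mul]
        exact mul_le_mul_of_nonneg_right hsd hΔ.le
      have h1 : ((((C ×ˢ C).filter (fun p => G p.1 p.2)).card : ℕ) : ℝ) ≤
          (((C' ×ˢ C').filter (fun p => G p.1 p.2)).card : ℝ) +
          ((((C \ C') ×ˢ C).filter (fun p => G p.1 p.2)).card +
            (((C \ C') ×ˢ C).filter (fun p => G p.1 p.2)).card) := by
        have := (card_le_card hsub).trans ((card_union_le _ _).trans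
          (Nat.add_le_add_left ((card_union_le _ _).trans
            (Nat.add_le_add_left card_image_le _)) _))
        exact_mod_cast this
      have h2 : (((C' ×ˢ C').filter (fun p => G p.1 p.2)).card : ℝ) = ∑ v ∈ C', (w v : ℝ) := by
        rw [card_filter_product_eq_sum, Nat.cast_sum]
      rw [← h2]
      linarith
    have hDcard : β / 4 * N ≤ (D.card : ℝ) := by
      have h1 := sum_le_heavy_add_light C' w Δ (β / 4 * Δ) (by positivity) hwle
      have h2 : (C'.card : ℝ) ≤ N := by exact_mod_cast (card_le_card hC').trans hC
      have h3 : β / 4 * Δ * C'.card ≤ β / 4 * Δ * N :=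
        mul_le_mul_of_nonneg_left h2 (by positivity)
      have h4 : Δ * (β / 4 * N) ≤ Δ * D.card := by linarith
      exact le_of_mul_le_mul_left h4 hΔ
    have hstep : ∀ v ∈ D, ∃ F : Finset (Finset α), F.card ≤ (N + 1) ^ t ∧
        (∀ D ∈ F, (D.card : ℝ) ≤ C.card - β / 4 * N) ∧
        ∀ I ⊆ C'.filter (fun u => ¬ G v u), (∀ u ∈ I, ∀ v ∈ I, ¬ G u v) → ∃ D ∈ F, I ⊆ D := by
      intro v hv
      refine ih _ ((filter_subset _ _).trans hC') ?_
      have h1 : (w v : ℝ) + (C'.filter (fun u => ¬ G v u)).card = C'.card := by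
        exact_mod_cast card_filter_add_card_filter_not (s := C') (G v)
      have h2 := (mem_filter.1 hv).2
      push_cast at h
      linarith
    choose! F hF1 hF2 hF3 using hstep
    refine ⟨insert (C' \ D) (D.biUnion F), ?_, ?_, ?_⟩
    · have h1 : (D.biUnion F).card ≤ N * (N + 1) ^ t :=
        (card_biUnion_le_card_mul _ _ _ hF1).trans (Nat.mul_le_mul_right _
          ((card_le_card (filter_subset _ _)).trans ((card_le_card hC').trans hC)))
      have h2 : 1 ≤ (N + 1) ^ t := Nat.one_le_pow _ _ (by omega)
      have h3 : (N + 1) ^ (t + 1) = N * (N + 1) ^ t + (N + 1) ^ t := by ring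
      have := card_insert_le (C' \ D) (D.biUnion F)
      omega
    · intro X hX
      rcases mem_insert.1 hX with rfl | hX
      · have h1 : ((C' \ D).card : ℝ) + D.card = C'.card := by
          exact_mod_cast card_sdiff_add_card_eq_card (filter_subset _ _)
        have h2 : (C'.card : ℝ) ≤ C.card := by exact_mod_cast card_le_card hC'
        linarith
      · obtain ⟨v, hv, hX⟩ := mem_biUnion.1 hX
        exact hF2 v hv X hX
    · intro I hI hind
      by_cases hID : ∃ v ∈ I, v ∈ D
      · obtain ⟨v, hvI, hvD⟩ := hID
        obtain ⟨X, hX, hIX⟩ := hF3 v hvD I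
          (fun u hu => mem_filter.2 ⟨hI hu, hind v hvI u hu⟩) hind
        exact ⟨X, mem_insert_of_mem (mem_biUnion.2 ⟨v, hvD, hX⟩), hIX⟩
      · push Not at hID
        exact ⟨C' \ D, mem_insert_self _ _, fun u hu => mem_sdiff.2 ⟨hI hu, hID u hu⟩⟩

open Classical in
/-- The number of ordered edges of a ternary relation inside a finite set. -/
noncomputable def edgeCount {α : Type*} (E : α → α → α → Prop) (C : Finset α) : ℕ :=
  ((C ×ˢ C ×ˢ C).filter (fun p => E p.1 p.2.1 p.2.2)).card

/-- A set without edges of a ternary relation. -/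
def EdgeFree {α : Type*} (E : α → α → α → Prop) (I : Finset α) : Prop :=
  ∀ u ∈ I, ∀ v ∈ I, ∀ w ∈ I, ¬ E u v w

open Classical in
/-- One shrinking round of the container algorithm: a set with many edges can be replaced by
a bounded number of substantially smaller ones. -/
lemma exists_shrinking_cover {α : Type*} (N s t : ℕ) (E : α → α → α → Prop)
    (h12 : ∀ u v w, E u v w → E u w v)
    (K ε : ℝ) (hK : 1 ≤ K) (hε : 0 < ε) (C : Finset α) (hC : C.card ≤ N)
    (hcodeg : ∀ u v, ((C.filter (E u v)).card : ℝ) ≤ K)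
    (hcodeg' : ∀ v w, ((C.filter (fun u => E u v w)).card : ℝ) ≤ K)
    (he : ε * N ^ 2 ≤ edgeCount E C) (hs : 1 ≤ s)
    (hsN : (s : ℝ) ≤ ε / (4 * K) * N) (hst : N ≤ t * s) :
    ∃ F : Finset (Finset α),
      F.card ≤ (C.powerset.filter (fun J => J.card ≤ s)).card * (N + 1) ^ t ∧
      (∀ D ∈ F, (D.card : ℝ) ≤ C.card - ε / (8 * K ^ 2) * N) ∧
      ∀ I ⊆ C, EdgeFree E I → ∃ D ∈ F, I ⊆ D := by
  have hK0 : (0 : ℝ) < K := by linarith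
  have hs0 : (1 : ℝ) ≤ s := by exact_mod_cast hs
  set deg : α → ℕ := fun u => ((C ×ˢ C).filter (fun p => E u p.1 p.2)).card with hdeg
  have hdegle : ∀ u ∈ C, (deg u : ℝ) ≤ K * N := by
    intro u _
    rw [hdeg]
    simp only
    rw [card_filter_product_eq_sum, Nat.cast_sum]
    refine (Finset.sum_le_card_nsmul _ _ K fun v _ => hcodeg u v).trans ?_
    rw [nsmul_eq_mul, mul_comm]
    exact mul_le_mul_of_nonneg_left (by exact_mod_cast hC) hK0.le
  set D := C.filter (fun u => ε / 2 * N ≤ deg u) with hD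
  have hNpos : (0 : ℝ) < N := by
    by_contra h
    have h' : (N : ℝ) ≤ 0 := not_lt.1 h
    have : ε / (4 * K) * N ≤ 0 := mul_nonpos_of_nonneg_of_nonpos (by positivity) h'
    linarith
  have hDcard : ε / (2 * K) * N ≤ (D.card : ℝ) := by
    have h1 := sum_le_heavy_add_light C deg (K * N) (ε / 2 * N) (by positivity) hdegle
    have h2 : ((edgeCount E C : ℕ) : ℝ) = ∑ u ∈ C, (deg u : ℝ) := by
      rw [edgeCount, card_filter_product_eq_sum C (C ×ˢ C) (fun a p => E a p.1 p.2),
        Nat.cast_sum]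
    have h3 : ε / 2 * N * C.card ≤ ε / 2 * N * N :=
      mul_le_mul_of_nonneg_left (by exact_mod_cast hC) (by positivity)
    have h4 : K * N * (ε / (2 * K) * N) ≤ K * N * D.card := by
      have : K * N * (ε / (2 * K) * N) = ε / 2 * N * N := by field_simp
      rw [this]
      nlinarith
    exact le_of_mul_le_mul_left h4 (by positivity)
  have hcmp : ε / (8 * K ^ 2) ≤ ε / (4 * K) := by
    gcongr <;> nlinarith
  have key : ∀ J ∈ D.powerset.filter (fun J => J.card ≤ s), ∃ F : Finset (Finset α),
      F.card ≤ (N + 1) ^ t ∧ (∀ X ∈ F, (X.card : ℝ) ≤ C.card - ε / (8 * K ^ 2) * N) ∧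
      ∀ I ⊆ C, EdgeFree E I → (J.card < s ∧ I ∩ D = J ∨ J.card = s ∧ J ⊆ I) →
        ∃ X ∈ F, I ⊆ X := by
    intro J hJ
    obtain ⟨hJD, hJs⟩ := mem_filter.1 hJ
    rw [mem_powerset] at hJD
    rcases hJs.lt_or_eq with hlt | heq
    · refine ⟨{C \ D ∪ J}, by simpa using Nat.one_le_pow _ _ (by omega), ?_, ?_⟩
      · intro X hX
        rw [mem_singleton.1 hX]
        have h1 : ((C \ D ∪ J).card : ℝ) ≤ (C \ D).card + J.card := by
          exact_mod_cast card_union_le _ _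
        have h2 : ((C \ D).card : ℝ) + D.card = C.card := by
          exact_mod_cast card_sdiff_add_card_eq_card (filter_subset _ _)
        have h3 : (J.card : ℝ) ≤ s := by exact_mod_cast hlt.le
        have h4 : ε / (2 * K) * N = 2 * (ε / (4 * K) * N) := by field_simp; norm_num
        have h5 : ε / (8 * K ^ 2) * N ≤ ε / (4 * K) * N := by gcongr
        linarith
      · rintro I hI - (⟨-, h⟩ | ⟨h, -⟩)
        · refine ⟨_, mem_singleton_self _, fun u hu => ?_⟩
          by_cases huD : u ∈ D
          · exact mem_union_right _ (h ▸ mem_inter.2 ⟨hu, huD⟩)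
          · exact mem_union_left _ (mem_sdiff.2 ⟨hI hu, huD⟩)
        · omega
    · obtain ⟨G, hGdef⟩ : ∃ G : α → α → Prop, ∀ v w, G v w ↔ ∃ u ∈ J, E u v w :=
        ⟨_, fun _ _ => Iff.rfl⟩
      have hG : ∀ v w, G v w → G w v := fun v w h => by
        obtain ⟨u, hu, h⟩ := (hGdef v w).1 h
        exact (hGdef w v).2 ⟨u, hu, h12 _ _ _ h⟩
      have hGdeg : ∀ v ∈ C, ((C.filter (G v)).card : ℝ) ≤ K * s := by
        intro v _
        have hsub : C.filter (G v) ⊆ J.biUnion (fun u => C.filter (E u v)) := by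
          intro w hw
          obtain ⟨hwC, hvw⟩ := mem_filter.1 hw
          obtain ⟨u, hu, h⟩ := (hGdef v w).1 hvw
          exact mem_biUnion.2 ⟨u, hu, mem_filter.2 ⟨hwC, h⟩⟩
        have h1 : ((C.filter (G v)).card : ℝ) ≤ ∑ u ∈ J, ((C.filter (E u v)).card : ℝ) := by
          exact_mod_cast (card_le_card hsub).trans card_biUnion_le
        refine h1.trans ((Finset.sum_le_card_nsmul _ _ K fun u _ => hcodeg u v).trans ?_)
        rw [nsmul_eq_mul, heq, mul_comm]
      have hGedge : ε / (2 * K ^ 2) * N * (K * s) ≤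
          ((C ×ˢ C).filter (fun p => G p.1 p.2)).card := by
        have h1 : (s : ℝ) * (ε / 2 * N) ≤ ∑ u ∈ J, (deg u : ℝ) := by
          have := Finset.card_nsmul_le_sum J (fun u => (deg u : ℝ)) (ε / 2 * N)
            fun u hu => (mem_filter.1 (hJD hu)).2
          rwa [nsmul_eq_mul, heq] at this
        have h2 : ∑ u ∈ J, (deg u : ℝ) ≤
            K * ((C ×ˢ C).filter (fun p => G p.1 p.2)).card := by
          have hsum : ∑ u ∈ J, deg u = ∑ p ∈ (C ×ˢ C).filter (fun p => G p.1 p.2),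
              (J.filter (fun u => E u p.1 p.2)).card := by
            have : ∀ u ∈ J, deg u = (((C ×ˢ C).filter (fun p => G p.1 p.2)).filter
                (fun p => E u p.1 p.2)).card := by
              intro u hu
              simp only [hdeg, filter_filter]
              refine congrArg Finset.card (Finset.ext fun p => ?_)
              simp only [mem_filter, and_congr_right_iff, iff_and_self]
              exact fun _ h => (hGdef _ _).2 ⟨u, hu, h⟩
            rw [sum_congr rfl this]
            simp only [card_filter _ (_ : Finset (α × α)), card_filter _ J]
            rw [sum_comm]
          have hsum' : ∑ u ∈ J, (deg u : ℝ) = ∑ p ∈ (C ×ˢ C).filter (fun p => G p.1 p.2),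
              ((J.filter (fun u => E u p.1 p.2)).card : ℝ) := by exact_mod_cast hsum
          rw [hsum']
          refine (Finset.sum_le_card_nsmul _ _ K fun p _ => ?_).trans ?_
          · refine le_trans ?_ (hcodeg' p.1 p.2)
            exact_mod_cast card_le_card (filter_subset_filter _ (hJD.trans (filter_subset _ _)))
          · rw [nsmul_eq_mul, mul_comm]
        have h3 : K * (ε / (2 * K ^ 2) * N * (K * s)) ≤
            K * ((C ×ˢ C).filter (fun p => G p.1 p.2)).card := by
          have : K * (ε / (2 * K ^ 2) * N * (K * s)) = s * (ε / 2 * N) := by field_simp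
          linarith
        exact le_of_mul_le_mul_left h3 hK0
      have hβ : ε / (2 * K ^ 2) / 4 = ε / (8 * K ^ 2) := by field_simp; norm_num
      obtain ⟨F, hF1, hF2, hF3⟩ := exists_graph_containers N G hG (K * s) (ε / (2 * K ^ 2))
        (by positivity) (by positivity) C hC hGdeg hGedge t C subset_rfl (by
          have h1 : (N : ℝ) ≤ t * s := by exact_mod_cast hst
          have h2 : (0 : ℝ) ≤ ε / (2 * K ^ 2) / 4 := by positivity
          have h3 : (t * s : ℝ) ≤ t * s * K := le_mul_of_one_le_right (by positivity) hK
          nlinarith [mul_le_mul_of_nonneg_left (h1.trans h3) h2])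
      refine ⟨F, hF1, fun X hX => by rw [← hβ]; exact hF2 X hX, ?_⟩
      rintro I hI hfree (⟨h, -⟩ | ⟨-, h⟩)
      · omega
      · exact hF3 I hI fun v hv w hw hvw => by
          obtain ⟨u, hu, hE⟩ := (hGdef v w).1 hvw
          exact hfree u (h hu) v hv w hw hE
  choose! F hF1 hF2 hF3 using key
  refine ⟨(D.powerset.filter (fun J => J.card ≤ s)).biUnion F, ?_, ?_, ?_⟩
  · refine (card_biUnion_le_card_mul _ _ _ hF1).trans (Nat.mul_le_mul_right _ (card_le_card ?_))
    exact filter_subset_filter _ (powerset_mono.2 (filter_subset _ _))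
  · intro X hX
    obtain ⟨J, hJ, hX⟩ := mem_biUnion.1 hX
    exact hF2 J hJ X hX
  · intro I hI hfree
    rcases lt_or_ge (I ∩ D).card s with hlt | hge
    · have hJ : I ∩ D ∈ D.powerset.filter (fun J => J.card ≤ s) :=
        mem_filter.2 ⟨mem_powerset.2 inter_subset_right, hlt.le⟩
      obtain ⟨X, hX, hIX⟩ := hF3 _ hJ I hI hfree (Or.inl ⟨hlt, rfl⟩)
      exact ⟨X, mem_biUnion.2 ⟨_, hJ, hX⟩, hIX⟩
    · obtain ⟨J, hJsub, hJcard⟩ := exists_subset_card_eq hge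
      have hJ : J ∈ D.powerset.filter (fun J => J.card ≤ s) :=
        mem_filter.2 ⟨mem_powerset.2 (hJsub.trans inter_subset_right), hJcard.le⟩
      obtain ⟨X, hX, hIX⟩ := hF3 _ hJ I hI hfree
        (Or.inr ⟨hJcard, hJsub.trans inter_subset_left⟩)
      exact ⟨X, mem_biUnion.2 ⟨_, hJ, hX⟩, hIX⟩

/-- A bound for the number of small subsets of a finite set. -/
lemma card_small_subsets_le {α : Type*} (C : Finset α) (N s : ℕ) (hC : C.card ≤ N) (x : ℝ)
    (hx0 : 0 < x) (hx1 : x ≤ 1) :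
    ((C.powerset.filter (fun J => J.card ≤ s)).card : ℝ) ≤
      Real.exp (x * N + s * Real.log x⁻¹) := by
  have h1 : ((C.powerset.filter (fun J => J.card ≤ s)).card : ℝ) * x ^ s ≤ (x + 1) ^ N := by
    calc ((C.powerset.filter (fun J => J.card ≤ s)).card : ℝ) * x ^ s
        = ∑ J ∈ C.powerset.filter (fun J => J.card ≤ s), x ^ s := by
          rw [sum_const, nsmul_eq_mul]
      _ ≤ ∑ J ∈ C.powerset.filter (fun J => J.card ≤ s), x ^ J.card :=
          sum_le_sum fun J hJ => pow_le_pow_of_le_one hx0.le hx1 (mem_filter.1 hJ).2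
      _ ≤ ∑ J ∈ C.powerset, x ^ J.card :=
          sum_le_sum_of_subset_of_nonneg (filter_subset _ _) fun _ _ _ => by positivity
      _ = (x + 1) ^ C.card := by
          rw [← Finset.sum_pow_mul_eq_add_pow]
          simp
      _ ≤ (x + 1) ^ N := pow_le_pow_right₀ (by linarith) hC
  have h2 : (x + 1) ^ N ≤ Real.exp (x * N) := by
    rw [mul_comm, Real.exp_nat_mul]
    exact pow_le_pow_left₀ (by positivity) (Real.add_one_le_exp x) N
  have h3 : Real.exp (s * Real.log x⁻¹) * x ^ s = 1 := by
    rw [Real.exp_nat_mul, Real.exp_log (by positivity), ← mul_pow, inv_mul_cancel₀ hx0.ne',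
      one_pow]
  rw [Real.exp_add]
  have h4 : 0 < x ^ s := by positivity
  refine le_of_mul_le_mul_right ?_ h4
  rw [mul_assoc, h3, mul_one]
  exact h1.trans h2

open Classical in
/-- A container theorem for ternary relations with bounded codegrees. -/
theorem exists_containers (K ε η : ℝ) (hK : 1 ≤ K) (hε : 0 < ε) (hη : 0 < η) :
    ∃ N₀ : ℕ, ∀ N : ℕ, N₀ ≤ N → ∀ {α : Type} (E : α → α → α → Prop) (C : Finset α),
      (∀ u v w, E u v w → E u w v) → C.card ≤ N →
      (∀ u v, ((C.filter (E u v)).card : ℝ) ≤ K) →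
      (∀ v w, ((C.filter (fun u => E u v w)).card : ℝ) ≤ K) →
      ∃ F : Finset (Finset α), (F.card : ℝ) ≤ Real.exp (η * N) ∧
        (∀ D ∈ F, D ⊆ C ∧ (edgeCount E D : ℝ) ≤ ε * N ^ 2) ∧
        ∀ I ⊆ C, EdgeFree E I → ∃ D ∈ F, I ⊆ D := by
  set c : ℝ := ε / (8 * K ^ 2) with hc
  have hK0 : 0 < K := by linarith
  have hc0 : 0 < c := by positivity
  set R : ℕ := ⌈1 / c⌉₊ + 1 with hR
  set η' : ℝ := η / R with hη'
  have hR0 : (0 : ℝ) < R := by positivity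
  have hη'0 : 0 < η' := by positivity
  set x : ℝ := min (η' / 4) (1 / 2) with hx
  have hx0 : 0 < x := by positivity
  have hx1 : x ≤ 1 / 2 := min_le_right _ _
  set L : ℝ := Real.log x⁻¹ with hL
  have hL0 : 0 < L := Real.log_pos (by
    rw [one_lt_inv₀ hx0]; linarith)
  set p : ℝ := min (η' / (8 * L)) (ε / (8 * K)) with hp
  have hp0 : 0 < p := by positivity
  set t : ℕ := ⌈1 / p⌉₊ with ht
  have hlog : ∀ᶠ N : ℕ in Filter.atTop, (t : ℝ) * Real.log (N + 1) ≤ η' / 4 * N := by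
    have h1 := (Real.isLittleO_log_id_atTop.comp_tendsto
      (Filter.tendsto_atTop_add_const_right _ (1 : ℝ) tendsto_natCast_atTop_atTop))
    have h2 := h1.bound (show (0 : ℝ) < η' / (8 * (t + 1)) by positivity)
    filter_upwards [h2, Filter.eventually_ge_atTop 1] with N hN hN1
    have hN1' : (1 : ℝ) ≤ N := by exact_mod_cast hN1
    simp only [Function.comp, id, Real.norm_eq_abs] at hN
    rw [abs_of_nonneg (Real.log_nonneg (by linarith)), abs_of_nonneg (by linarith : (0:ℝ) ≤ N + 1)]
      at hN
    calc (t : ℝ) * Real.log (N + 1) ≤ (t + 1) * Real.log (N + 1) :=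
          mul_le_mul_of_nonneg_right (by linarith) (Real.log_nonneg (by linarith))
      _ ≤ (t + 1) * (η' / (8 * (t + 1)) * (N + 1)) :=
          mul_le_mul_of_nonneg_left hN (by positivity)
      _ = η' / 8 * (N + 1) := by field_simp
      _ ≤ η' / 4 * N := by nlinarith
  obtain ⟨N₁, hN₁⟩ := Filter.eventually_atTop.1 hlog
  refine ⟨max N₁ (max ⌈8 * L / η'⌉₊ ⌈8 * K / ε⌉₊ + 1), ?_⟩
  intro N hN α E C hsymm hC hcod hcod'
  have hNN₁ : N₁ ≤ N := le_trans (le_max_left _ _) hN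
  have hN' : max ⌈8 * L / η'⌉₊ ⌈8 * K / ε⌉₊ + 1 ≤ N := le_trans (le_max_right _ _) hN
  have hN0 : 1 ≤ N := by omega
  have hNL : 8 * L / η' ≤ N := (Nat.le_ceil _).trans (by
    exact_mod_cast (le_max_left _ ⌈8 * K / ε⌉₊).trans (by omega))
  have hNK : 8 * K / ε ≤ N := (Nat.le_ceil _).trans (by
    exact_mod_cast (le_max_right ⌈8 * L / η'⌉₊ _).trans (by omega))
  have hNpos : (0 : ℝ) < N := by exact_mod_cast hN0
  set s : ℕ := ⌈p * N⌉₊ with hs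
  have hs1 : 1 ≤ s := Nat.one_le_iff_ne_zero.2 (by
    have : 0 < s := Nat.ceil_pos.2 (by positivity)
    omega)
  have hsle : (s : ℝ) ≤ p * N + 1 := (Nat.ceil_lt_add_one (by positivity)).le
  have hsN : (s : ℝ) ≤ ε / (4 * K) * N := by
    have h1 : p * N ≤ ε / (8 * K) * N := mul_le_mul_of_nonneg_right (min_le_right _ _) hNpos.le
    have h2 : 1 ≤ ε / (8 * K) * N := by
      rw [div_le_iff₀ hε] at hNK
      rw [div_mul_eq_mul_div, le_div_iff₀ (by positivity)]
      linarith
    have h3 : ε / (4 * K) * N = ε / (8 * K) * N + ε / (8 * K) * N := by field_simp; norm_num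
    linarith
  have hst : N ≤ t * s := by
    have h1 : (N : ℝ) ≤ t * s := by
      calc (N : ℝ) = (1 / p) * (p * N) := by field_simp
        _ ≤ t * s := mul_le_mul (Nat.le_ceil _) (Nat.le_ceil _) (by positivity) (by positivity)
    exact_mod_cast h1
  have hcount : ∀ X ⊆ C, (((X.powerset.filter (fun J => J.card ≤ s)).card * (N + 1) ^ t : ℕ) : ℝ)
      ≤ Real.exp (η' * N) := by
    intro X hX
    have h1 := card_small_subsets_le X N s ((card_le_card hX).trans hC) x hx0 (by linarith)
    have h2 : ((N : ℝ) + 1) ^ t ≤ Real.exp (η' / 4 * N) := by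
      rw [← Real.exp_log (show (0 : ℝ) < (N + 1) by positivity), ← Real.exp_nat_mul]
      exact Real.exp_le_exp.2 (hN₁ N hNN₁)
    have h3 : x * N + s * L ≤ η' / 2 * N := by
      have h4 : x * N ≤ η' / 4 * N := mul_le_mul_of_nonneg_right (min_le_left _ _) hNpos.le
      have h5 : s * L ≤ (p * N + 1) * L := mul_le_mul_of_nonneg_right hsle hL0.le
      have h6 : p * L ≤ η' / 8 := by
        calc p * L ≤ η' / (8 * L) * L := mul_le_mul_of_nonneg_right (min_le_left _ _) hL0.le
          _ = η' / 8 := by field_simp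
      have h7 : L ≤ η' / 8 * N := by
        rw [div_le_iff₀ hη'0] at hNL
        linarith
      nlinarith [mul_le_mul_of_nonneg_right h6 hNpos.le]
    push_cast
    calc _ ≤ Real.exp (x * N + s * L) * Real.exp (η' / 4 * N) :=
          mul_le_mul h1 h2 (by positivity) (Real.exp_pos _).le
      _ = Real.exp (x * N + s * L + η' / 4 * N) := (Real.exp_add _ _).symm
      _ ≤ Real.exp (η' * N) := Real.exp_le_exp.2 (by nlinarith)
  have main : ∀ j : ℕ, ∀ X ⊆ C, (X.card : ℝ) ≤ j * (c * N) →
      ∃ F : Finset (Finset α), (F.card : ℝ) ≤ Real.exp (j * (η' * N)) ∧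
        (∀ D ∈ F, D ⊆ C ∧ (edgeCount E D : ℝ) ≤ ε * N ^ 2) ∧
        ∀ I ⊆ X, EdgeFree E I → ∃ D ∈ F, I ⊆ D := by
    intro j
    induction j with
    | zero =>
      intro X hX h
      have hX0 : X = ∅ := by
        rw [← card_eq_zero]
        have : (X.card : ℝ) ≤ 0 := by simpa using h
        exact Nat.le_zero.1 (by exact_mod_cast this)
      refine ⟨{∅}, by simp, ?_, fun I hI _ => ⟨∅, by simp, hX0 ▸ hI⟩⟩
      intro D hD
      rw [mem_singleton.1 hD]
      refine ⟨empty_subset _, ?_⟩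
      simp [edgeCount]
      positivity
    | succ j ih =>
      intro X hX h
      by_cases hfew : (edgeCount E X : ℝ) ≤ ε * N ^ 2
      · refine ⟨{X}, ?_, by simpa using ⟨hX, hfew⟩, fun I hI _ => ⟨X, by simp, hI⟩⟩
        rw [card_singleton, Nat.cast_one]
        exact Real.one_le_exp (by positivity)
      · obtain ⟨F₁, hF1, hF2, hF3⟩ := exists_shrinking_cover N s t E hsymm K ε hK hε X
          ((card_le_card hX).trans hC)
          (fun u v => le_trans (by exact_mod_cast card_le_card (filter_subset_filter _ hX))
            (hcod u v))
          (fun u v => le_trans (by exact_mod_cast card_le_card (filter_subset_filter _ hX))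
            (hcod' u v))
          (not_le.1 hfew).le hs1 hsN hst
        have hstep : ∀ D ∈ F₁, ∃ F : Finset (Finset α), (F.card : ℝ) ≤ Real.exp (j * (η' * N)) ∧
            (∀ D ∈ F, D ⊆ C ∧ (edgeCount E D : ℝ) ≤ ε * N ^ 2) ∧
            ∀ I ⊆ D ∩ X, EdgeFree E I → ∃ D ∈ F, I ⊆ D := by
          intro D hD
          refine ih (D ∩ X) (inter_subset_right.trans hX) ?_
          have h1 := hF2 D hD
          have h2 : ((D ∩ X).card : ℝ) ≤ D.card := by
            exact_mod_cast card_le_card inter_subset_left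
          push_cast at h
          linarith
        choose! F hG1 hG2 hG3 using hstep
        refine ⟨F₁.biUnion F, ?_, ?_, ?_⟩
        · have h1 : ((F₁.biUnion F).card : ℝ) ≤ ∑ D ∈ F₁, ((F D).card : ℝ) := by
            exact_mod_cast card_biUnion_le
          have h2 : (F₁.card : ℝ) ≤ Real.exp (η' * N) :=
            le_trans (by exact_mod_cast hF1) (hcount X hX)
          refine h1.trans ((Finset.sum_le_card_nsmul _ _ _ hG1).trans ?_)
          rw [nsmul_eq_mul]
          have h3 : ((j + 1 : ℕ) : ℝ) * (η' * N) = η' * N + j * (η' * N) := by push_cast; ring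
          rw [h3, Real.exp_add]
          exact mul_le_mul_of_nonneg_right h2 (Real.exp_pos _).le
        · intro D hD
          obtain ⟨D', hD', hD⟩ := mem_biUnion.1 hD
          exact hG2 D' hD' D hD
        · intro I hI hfree
          obtain ⟨D, hD, hID⟩ := hF3 I hI hfree
          obtain ⟨D', hD', hID'⟩ := hG3 D hD I (subset_inter hID hI) hfree
          exact ⟨D', mem_biUnion.2 ⟨D, hD, hD'⟩, hID'⟩
  obtain ⟨F, hF1, hF2, hF3⟩ := main R C subset_rfl (by
    have h1 : (1 / c : ℝ) ≤ R := (Nat.le_ceil _).trans (by rw [hR]; push_cast; linarith)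
    have h2 : (C.card : ℝ) ≤ N := by exact_mod_cast hC
    rw [div_le_iff₀ hc0] at h1
    nlinarith)
  refine ⟨F, ?_, hF2, hF3⟩
  have : (R : ℝ) * (η' * N) = η * N := by
    rw [hη']
    field_simp
  rwa [this] at hF1

open Classical in
/-- The exceptions, among the `x` with `x, x + d ∈ [1, N]`, to the rule that `x` and `x + d`
agree (if `c`) or disagree (if not `c`) about membership in `S`. -/
noncomputable def shiftExc (S : Finset ℕ) (N d : ℕ) (c : Prop) : Finset ℕ :=
  (Finset.Icc 1 (N - d)).filter (fun x => ¬ (x + d ∈ S ↔ (x ∈ S ↔ c)))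

open Classical in
lemma mem_shiftExc {S : Finset ℕ} {N d : ℕ} {c : Prop} {x : ℕ} :
    x ∈ shiftExc S N d c ↔ (1 ≤ x ∧ x ≤ N - d) ∧ ¬ (x + d ∈ S ↔ (x ∈ S ↔ c)) := by
  rw [shiftExc, mem_filter, mem_Icc]

lemma shiftExc_rule {S : Finset ℕ} {N d : ℕ} {c : Prop} {x : ℕ} (hx : x ∉ shiftExc S N d c)
    (h1 : 1 ≤ x) (h2 : x + d ≤ N) : x + d ∈ S ↔ (x ∈ S ↔ c) := by
  by_contra h
  exact hx (mem_shiftExc.2 ⟨⟨h1, by omega⟩, h⟩)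

lemma shiftExc_false_rule {S : Finset ℕ} {N d : ℕ} {x : ℕ} (hx : x ∉ shiftExc S N d False)
    (h1 : 1 ≤ x) (h2 : x + d ≤ N) : x + d ∈ S ↔ x ∉ S := by
  rw [shiftExc_rule hx h1 h2, iff_false]

lemma not_mem_of_not_mem_image_sub {Z : Finset ℕ} {x s : ℕ}
    (h : x ∉ Z.image (fun z => z - s)) : x + s ∉ Z :=
  fun hx => h (mem_image.2 ⟨x + s, hx, by omega⟩)

lemma not_mem_of_not_mem_image_add {Z : Finset ℕ} {x s : ℕ} (hs : s ≤ x)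
    (h : x ∉ Z.image (fun z => z + s)) : x - s ∉ Z :=
  fun hx => h (mem_image.2 ⟨x - s, hx, by omega⟩)

lemma card_shiftExc_zero (S : Finset ℕ) (N : ℕ) : (shiftExc S N 0 True).card = 0 := by
  rw [card_eq_zero, eq_empty_iff_forall_notMem]
  intro x hx
  simp [mem_shiftExc] at hx

lemma card_shiftExc_true_add_false (S : Finset ℕ) (N d : ℕ) :
    (shiftExc S N d True).card + (shiftExc S N d False).card = N - d := by
  classical
  rw [← card_union_of_disjoint]
  · rw [show N - d = (Finset.Icc 1 (N - d)).card by rw [Nat.card_Icc, Nat.add_sub_cancel]]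
    congr 1
    ext x
    simp only [mem_union, mem_shiftExc, mem_Icc]
    tauto
  · rw [disjoint_left]
    intro x hx hx'
    have h1 := (mem_shiftExc.1 hx).2
    have h2 := (mem_shiftExc.1 hx').2
    tauto

lemma card_shiftExc_add (S : Finset ℕ) (N d d' : ℕ) (c c' : Prop) :
    (shiftExc S N (d + d') (c ↔ c')).card ≤ (shiftExc S N d c).card +
      (shiftExc S N d' c').card := by
  classical
  refine (card_le_card (t := shiftExc S N d c ∪
    (shiftExc S N d' c').image (fun z => z - d)) ?_).trans
    ((card_union_le _ _).trans (Nat.add_le_add_left card_image_le _))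
  intro x hx
  by_contra hcon
  rw [mem_union, not_or] at hcon
  obtain ⟨hx1, hx2⟩ := mem_shiftExc.1 hx
  have h1 := shiftExc_rule hcon.1 hx1.1 (by omega)
  have h2 := shiftExc_rule (not_mem_of_not_mem_image_sub hcon.2) (by omega) (by omega)
  rw [add_assoc] at h2
  tauto

/-- The difference of two almost-antiperiods is an almost-period. -/
lemma card_shiftExc_sub (S : Finset ℕ) (N a d : ℕ) (h : 2 * a + d ≤ N) :
    (shiftExc S N d True).card ≤ 2 * ((shiftExc S N a False).card +
      (shiftExc S N (a + d) False).card) := by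
  classical
  set X := shiftExc S N a False
  set Y := shiftExc S N (a + d) False
  have hsub : shiftExc S N d True ⊆ (Y ∪ X.image (fun z => z - d)) ∪
      (X.image (fun z => z + a) ∪ Y.image (fun z => z + a)) := by
    intro x hx
    by_contra hcon
    simp only [mem_union, not_or] at hcon
    obtain ⟨⟨h1, h2⟩, h3, h4⟩ := hcon
    obtain ⟨hx1, hx2⟩ := mem_shiftExc.1 hx
    by_cases hxa : x + (a + d) ≤ N
    · have e1 := shiftExc_rule h1 hx1.1 hxa
      have e2 := shiftExc_rule (not_mem_of_not_mem_image_sub h2) (by omega) (by omega)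
      rw [show x + d + a = x + (a + d) by omega] at e2
      tauto
    · have e1 := shiftExc_rule (not_mem_of_not_mem_image_add (by omega) h3) (by omega) (by omega)
      have e2 := shiftExc_rule (not_mem_of_not_mem_image_add (by omega) h4) (by omega) (by omega)
      rw [show x - a + a = x by omega] at e1
      rw [show x - a + (a + d) = x + d by omega] at e2
      tauto
  have h1 := card_le_card hsub
  have h2 := card_union_le (Y ∪ X.image (fun z => z - d))
    (X.image (fun z => z + a) ∪ Y.image (fun z => z + a))
  have h3 := card_union_le Y (X.image (fun z => z - d))
  have h4 := card_union_le (X.image (fun z => z + a)) (Y.image (fun z => z + a))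
  have h5 : (X.image (fun z => z - d)).card ≤ X.card := card_image_le
  have h6 : (X.image (fun z => z + a)).card ≤ X.card := card_image_le
  have h7 : (Y.image (fun z => z + a)).card ≤ Y.card := card_image_le
  omega

open Classical in
/-- The elements `x` of `S` such that `x + w` lies in `[1, N]` but not in `S`. -/
noncomputable def escaping (S : Finset ℕ) (N w : ℕ) : Finset ℕ :=
  S.filter (fun x => x + w ≤ N ∧ x + w ∉ S)

lemma mem_of_not_mem_escaping {S : Finset ℕ} {N w x : ℕ} (h : x ∉ escaping S N w) (hx : x ∈ S)
    (hxw : x + w ≤ N) : x + w ∈ S := by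
  by_contra h'
  exact h (mem_filter.2 ⟨hx, hxw, h'⟩)

/-- If `y` is an almost-antiperiod and translation by `y + d` almost preserves `S`, then
`d` is an almost-antiperiod. -/
lemma card_shiftExc_of_escaping (S : Finset ℕ) (N y d : ℕ) (h : 3 * y + d ≤ N) :
    (shiftExc S N d False).card ≤ 6 * (shiftExc S N y False).card +
      4 * (escaping S N (y + d)).card := by
  classical
  set X := shiftExc S N y False
  set W := escaping S N (y + d)
  have hsub : shiftExc S N d False ⊆
      (((X ∪ X.image (fun z => z - d)) ∪ (X.image (fun z => z + y) ∪
        X.image (fun z => z - (y + d)))) ∪ (X.image (fun z => z + 2 * y) ∪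
        (X.image (fun z => z - d)).image (fun z => z + y))) ∪
      ((W ∪ W.image (fun z => z + y)) ∪ (W.image (fun z => z - y) ∪
        W.image (fun z => z + 2 * y))) := by
    intro x hx
    by_contra hcon
    simp only [mem_union, not_or] at hcon
    obtain ⟨⟨⟨⟨x0, xd⟩, xmy, xyd⟩, xm2y, xdmy⟩, ⟨w0, wmy⟩, wy, wm2y⟩ := hcon
    obtain ⟨hx1, hx2⟩ := mem_shiftExc.1 hx
    rw [iff_false] at hx2
    by_cases hxS : x ∈ S
    · have hxd : x + d ∈ S := by_contra fun h => hx2 (iff_of_false h (not_not.2 hxS))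
      by_cases hr : x + (y + d) ≤ N
      · have e1 := mem_of_not_mem_escaping w0 hxS hr
        have e2 := shiftExc_false_rule (not_mem_of_not_mem_image_sub xd) (by omega) (by omega)
        rw [show x + d + y = x + (y + d) by omega] at e2
        exact e2.1 e1 hxd
      · have e1 := shiftExc_false_rule (not_mem_of_not_mem_image_add (by omega) xmy) (by omega)
          (by omega)
        rw [show x - y + y = x by omega] at e1
        have e2 := shiftExc_false_rule (not_mem_of_not_mem_image_add (by omega) xm2y) (by omega)
          (by omega)
        rw [show x - 2 * y + y = x - y by omega] at e2
        have h2y : x - 2 * y ∈ S := by_contra fun h => e1.1 hxS (e2.2 h)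
        have e3 := mem_of_not_mem_escaping
          (not_mem_of_not_mem_image_add (by omega) wm2y) h2y (by omega)
        rw [show x - 2 * y + (y + d) = x - y + d by omega] at e3
        have e4 := shiftExc_false_rule (not_mem_of_not_mem_image_sub
          (not_mem_of_not_mem_image_add (by omega) xdmy)) (by omega) (by omega)
        rw [show x - y + d + y = x + d by omega] at e4
        exact e4.1 hxd e3
    · have hxd : x + d ∉ S := fun h => hx2 (iff_of_true h hxS)
      by_cases hr : y < x
      · have e1 := shiftExc_false_rule (not_mem_of_not_mem_image_add (by omega) xmy) (by omega)
          (by omega)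
        rw [show x - y + y = x by omega] at e1
        have hy : x - y ∈ S := by_contra fun h => hxS (e1.2 h)
        have e3 := mem_of_not_mem_escaping
          (not_mem_of_not_mem_image_add (by omega) wmy) hy (by omega)
        rw [show x - y + (y + d) = x + d by omega] at e3
        exact hxd e3
      · have e1 := shiftExc_false_rule x0 (by omega) (by omega)
        have hy : x + y ∈ S := e1.2 hxS
        have e2 := mem_of_not_mem_escaping (not_mem_of_not_mem_image_sub wy) hy (by omega)
        have e3 := shiftExc_false_rule (not_mem_of_not_mem_image_sub xyd) (by omega) (by omega)
        rw [show x + (y + d) + y = x + y + (y + d) by omega] at e3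
        have e4 := shiftExc_false_rule (not_mem_of_not_mem_image_sub xd) (by omega) (by omega)
        rw [show x + d + y = x + (y + d) by omega] at e4
        exact e3.1 e2 (e4.2 hxd)
  have h1 := card_le_card hsub
  have i1 : (X.image (fun z => z - d)).card ≤ X.card := card_image_le
  have i2 : (X.image (fun z => z + y)).card ≤ X.card := card_image_le
  have i3 : (X.image (fun z => z - (y + d))).card ≤ X.card := card_image_le
  have i4 : (X.image (fun z => z + 2 * y)).card ≤ X.card := card_image_le
  have i5 : ((X.image (fun z => z - d)).image (fun z => z + y)).card ≤ X.card :=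
    card_image_le.trans card_image_le
  have i6 : (W.image (fun z => z + y)).card ≤ W.card := card_image_le
  have i7 : (W.image (fun z => z - y)).card ≤ W.card := card_image_le
  have i8 : (W.image (fun z => z + 2 * y)).card ≤ W.card := card_image_le
  have u (A B : Finset ℕ) : (A ∪ B).card ≤ A.card + B.card := card_union_le A B
  refine h1.trans ((u _ _).trans ?_)
  grw [u (X ∪ _ ∪ _), u (X ∪ _), u X, u (X.image _) (X.image _), u (X.image _) (Finset.image _ _),
    u (W ∪ _), u W, u (W.image _)]
  omega

/-- The failures of antisymmetry of `S` under the reflection `x ↦ N - x`. -/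
def reflExc (S : Finset ℕ) (N : ℕ) : Finset ℕ :=
  (Finset.Icc 1 (N - 1)).filter (fun x => x ∈ S ↔ N - x ∈ S)

lemma reflExc_rule {S : Finset ℕ} {N x : ℕ} (hx : x ∉ reflExc S N) (h1 : 1 ≤ x) (h2 : x < N) :
    N - x ∈ S ↔ x ∉ S := by
  by_contra h
  refine hx (mem_filter.2 ⟨mem_Icc.2 ⟨h1, by omega⟩, ?_⟩)
  tauto

lemma card_reflExc_le {S : Finset ℕ} {N : ℕ} {t : ℝ} (hS : S ⊆ Finset.Icc 1 N) (ht : 1 ≤ t)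
    (h0 : (N : ℝ) / 2 - t ≤ S.card) (h1 : ((S.filter (fun x => N - x ∈ S)).card : ℝ) ≤ t) :
    ((reflExc S N).card : ℝ) ≤ 6 * t := by
  set Z := Finset.Icc 1 (N - 1) with hZ
  set A := Z.filter (fun x => x ∈ S) with hA
  set B := Z.filter (fun x => N - x ∈ S) with hB
  have hAS : S.card ≤ A.card + 1 := by
    have : S ⊆ insert N A := by
      intro x hx
      have := mem_Icc.1 (hS hx)
      rw [mem_insert, hA, mem_filter, hZ, mem_Icc]
      by_cases hxN : x = N
      · exact Or.inl hxN
      · exact Or.inr ⟨by omega, hx⟩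
    exact (card_le_card this).trans (card_insert_le _ _)
  have hAB : A.card ≤ B.card := by
    refine card_le_card_of_injOn (fun x => N - x) ?_ ?_
    · intro x hx
      simp only [hA, hB, hZ, coe_filter, mem_Icc, Set.mem_ofPred_eq] at hx ⊢
      refine ⟨by omega, ?_⟩
      rw [show N - (N - x) = x by omega]
      exact hx.2
    · intro x hx y hy hxy
      simp only [hA, hZ, coe_filter, mem_Icc, Set.mem_ofPred_eq] at hx hy hxy
      omega
  have hI : A ∩ B ⊆ S.filter (fun x => N - x ∈ S) := by
    intro x hx
    simp only [hA, hB, mem_inter, mem_filter] at hx ⊢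
    tauto
  have hR : reflExc S N ⊆ (A ∩ B) ∪ (Z \ (A ∪ B)) := by
    intro x hx
    simp only [reflExc, hA, hB, ← hZ, mem_inter, mem_union, mem_sdiff, mem_filter] at hx ⊢
    tauto
  have e1 := card_union_add_card_inter A B
  have e2 := card_sdiff_add_card_eq_card
    (union_subset (filter_subset _ _) (filter_subset _ _) : A ∪ B ⊆ Z)
  have e3 : Z.card ≤ N := by rw [hZ, Nat.card_Icc]; omega
  have e4 := (card_le_card hR).trans (card_union_le _ _)
  have e5 : ((A ∩ B).card : ℝ) ≤ t := le_trans (by exact_mod_cast card_le_card hI) h1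
  have e6 : (reflExc S N).card + 2 * S.card ≤ N + 2 + 2 * (A ∩ B).card := by omega
  have e7 : ((reflExc S N).card : ℝ) + 2 * S.card ≤ N + 2 + 2 * (A ∩ B).card := by
    exact_mod_cast e6
  linarith

lemma card_shiftExc_false_le {S : Finset ℕ} {N a : ℕ} {t : ℝ} (ht : 1 ≤ t)
    (hR : ((reflExc S N).card : ℝ) ≤ 6 * t)
    (ha : ((S.filter (fun x => x + a ∈ S)).card : ℝ) ≤ t) :
    ((shiftExc S N a False).card : ℝ) ≤ 15 * t := by
  set P := S.filter (fun x => x + a ∈ S) with hP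
  set R := reflExc S N with hRdef
  have hsub : shiftExc S N a False ⊆ (P ∪ {N - a}) ∪
      ((R ∪ R.image (fun z => z - a)) ∪ P.image (fun z => N - a - z)) := by
    intro x hx
    by_contra hcon
    simp only [mem_union, not_or, mem_singleton] at hcon
    obtain ⟨⟨h1, h2⟩, ⟨h3, h4⟩, h5⟩ := hcon
    obtain ⟨hx1, hx2⟩ := mem_shiftExc.1 hx
    rw [iff_false] at hx2
    have h1' : ¬ (x ∈ S ∧ x + a ∈ S) := fun h => h1 (mem_filter.2 h)
    have e1 := reflExc_rule h3 hx1.1 (by omega)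
    have e2 := reflExc_rule (not_mem_of_not_mem_image_sub h4) (by omega) (by omega)
    refine h5 (mem_image.2 ⟨N - a - x, mem_filter.2 ⟨?_, ?_⟩, by omega⟩)
    · rw [show N - a - x = N - (x + a) by omega]
      tauto
    · rw [show N - a - x + a = N - x by omega]
      tauto
  have u (A B : Finset ℕ) : (A ∪ B).card ≤ A.card + B.card := card_union_le A B
  have h1 := (card_le_card hsub).trans (u _ _)
  grw [u P, u (R ∪ _), u R] at h1
  have h2 : (R.image (fun z => z - a)).card ≤ R.card := card_image_le
  have h3 : (P.image (fun z => N - a - z)).card ≤ P.card := card_image_le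
  rw [card_singleton] at h1
  have h4 : (shiftExc S N a False).card ≤ 2 * P.card + 2 * R.card + 1 := by omega
  have h5 : ((shiftExc S N a False).card : ℝ) ≤ 2 * P.card + 2 * R.card + 1 := by
    exact_mod_cast h4
  linarith

/-- Few `w ∉ S` have the property that translation by `w` moves many points out of `S`. -/
lemma card_bad_translations_le {S A : Finset ℕ} {N : ℕ} {t q : ℝ} (hS : S ⊆ Finset.Icc 1 N)
    (ht : 1 ≤ t) (hA : ∀ a ∈ A, ((shiftExc S N a False).card : ℝ) ≤ 15 * t)
    (hSA : ((S \ A).card : ℝ) ≤ t) :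
    q * ((Finset.Icc 1 N \ S).filter (fun w => q ≤ (escaping S N w).card)).card ≤
      16 * t * N := by
  set T := Finset.Icc 1 N \ S with hT
  have hsum : ∑ w ∈ T, (escaping S N w).card =
      ∑ x ∈ S, (T.filter (fun w => x + w ≤ N ∧ x + w ∉ S)).card := by
    simp only [escaping, card_filter]
    rw [sum_comm]
  have hx1 : ∀ x ∈ S.filter (fun x => x ∈ A),
      ((T.filter (fun w => x + w ≤ N ∧ x + w ∉ S)).card : ℝ) ≤ 15 * t := by
    intro x hx
    refine le_trans ?_ (hA x (mem_filter.1 hx).2)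
    have : T.filter (fun w => x + w ≤ N ∧ x + w ∉ S) ⊆ shiftExc S N x False := by
      intro w hw
      simp only [hT, mem_filter, mem_sdiff, mem_Icc] at hw
      rw [mem_shiftExc, add_comm w x]
      refine ⟨by omega, ?_⟩
      tauto
    exact_mod_cast card_le_card this
  have hx2 : ∀ x ∈ S.filter (fun x => x ∉ A),
      ((T.filter (fun w => x + w ≤ N ∧ x + w ∉ S)).card : ℝ) ≤ N := by
    intro x _
    have h1 : (T.filter (fun w => x + w ≤ N ∧ x + w ∉ S)).card ≤ (Finset.Icc 1 N).card :=
      card_le_card ((filter_subset _ _).trans sdiff_subset)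
    rw [Nat.card_Icc, Nat.add_sub_cancel] at h1
    exact_mod_cast h1
  have hSN : (S.card : ℝ) ≤ N := by
    have := card_le_card hS
    rw [Nat.card_Icc, Nat.add_sub_cancel] at this
    exact_mod_cast this
  have htotal : (∑ w ∈ T, ((escaping S N w).card : ℝ)) ≤ 16 * t * N := by
    rw [← Nat.cast_sum, hsum, Nat.cast_sum, ← sum_filter_add_sum_filter_not S (fun x => x ∈ A)]
    have b1 := Finset.sum_le_card_nsmul _ _ _ hx1
    have b2 := Finset.sum_le_card_nsmul _ _ _ hx2
    rw [nsmul_eq_mul] at b1 b2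
    rw [filter_notMem_eq_sdiff] at b2
    have b3 : ((S.filter (fun x => x ∈ A)).card : ℝ) ≤ N :=
      le_trans (by exact_mod_cast card_filter_le _ _) hSN
    have hN : (0 : ℝ) ≤ N := Nat.cast_nonneg _
    rw [filter_notMem_eq_sdiff]
    nlinarith
  have hlow := Finset.card_nsmul_le_sum (T.filter (fun w => q ≤ (escaping S N w).card))
    (fun w => ((escaping S N w).card : ℝ)) q fun w hw => (mem_filter.1 hw).2
  rw [nsmul_eq_mul, mul_comm] at hlow
  exact hlow.trans ((sum_le_sum_of_subset_of_nonneg (filter_subset _ _)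
    fun _ _ _ => Nat.cast_nonneg _).trans htotal)

/-- If `A` has an element well below `N / 2`, then `S` has many elements below `N / 3`. -/
lemma card_le_card_below_third {S A : Finset ℕ} {N K a : ℕ} {t : ℝ} (ht : 1 ≤ t)
    (hR : ((reflExc S N).card : ℝ) ≤ 6 * t) (hSA : ((S \ A).card : ℝ) ≤ t)
    (ha1 : N < 4 * a) (ha2 : 2 * a < N)
    (haexc : ((shiftExc S N a False).card : ℝ) ≤ 15 * t) :
    min ((N : ℝ) / 2 - a) ((N : ℝ) / 12 - K / 3) - 21 * t ≤
      (A.filter (fun y => 3 * y + K ≤ N)).card := by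
  set L := N - 2 * a with hL
  set X := shiftExc S N a False with hX
  set R := reflExc S N with hRdef
  set Z := Finset.Icc 1 (L - 1) with hZ
  set S₀ := Z.filter (fun x => x ∈ S) with hS₀
  have hcov : Z ⊆ (S₀ ∪ S₀.image (fun x => L - x)) ∪
      ((X ∪ X.image (fun z => z - a)) ∪ R.image (fun z => z - 2 * a)) := by
    intro x hx
    by_contra hcon
    simp only [mem_union, not_or] at hcon
    obtain ⟨⟨h1, h2⟩, ⟨h3, h4⟩, h5⟩ := hcon
    have hx' := mem_Icc.1 hx
    have hxS : x ∉ S := fun h => h1 (mem_filter.2 ⟨hx, h⟩)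
    have e1 := shiftExc_false_rule h3 hx'.1 (by omega)
    have e2 := shiftExc_false_rule (not_mem_of_not_mem_image_sub h4) (by omega) (by omega)
    have e3 := reflExc_rule (not_mem_of_not_mem_image_sub h5) (by omega) (by omega)
    rw [show x + a + a = x + 2 * a by omega] at e2
    refine h2 (mem_image.2 ⟨L - x, mem_filter.2 ⟨mem_Icc.2 (by omega), ?_⟩, by omega⟩)
    rw [show L - x = N - (x + 2 * a) by omega]
    tauto
  have hS₀sub : S₀ ⊆ (S \ A) ∪ (A.filter (fun y => 3 * y + K ≤ N) ∪
      Z.filter (fun y => N < 3 * y + K)) := by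
    intro x hx
    simp only [hS₀, mem_filter, mem_union, mem_sdiff] at hx ⊢
    by_cases hxA : x ∈ A
    · by_cases h : 3 * x + K ≤ N
      · tauto
      · exact Or.inr (Or.inr ⟨hx.1, by omega⟩)
    · tauto
  have hZhigh : 3 * (Z.filter (fun y => N < 3 * y + K)).card ≤ 3 * L + K - N + 2 := by
    have : Z.filter (fun y => N < 3 * y + K) ⊆ Finset.Icc ((N - K) / 3 + 1) (L - 1) := by
      intro y hy
      simp only [hZ, mem_filter, mem_Icc] at hy ⊢
      omega
    have := card_le_card this
    rw [Nat.card_Icc] at this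
    omega
  have u (A B : Finset ℕ) : (A ∪ B).card ≤ A.card + B.card := card_union_le A B
  have c1 := (card_le_card hcov).trans (u _ _)
  grw [u S₀, u (X ∪ _), u X] at c1
  have i1 : (S₀.image (fun x => L - x)).card ≤ S₀.card := card_image_le
  have i2 : (X.image (fun z => z - a)).card ≤ X.card := card_image_le
  have i3 : (R.image (fun z => z - 2 * a)).card ≤ R.card := card_image_le
  have hZc : Z.card = L - 1 := by rw [hZ, Nat.card_Icc]; omega
  have c2 : L ≤ 2 * S₀.card + 2 * X.card + R.card + 1 := by omega
  have c3 := (card_le_card hS₀sub).trans (u _ _)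
  grw [u (A.filter _)] at c3
  set Y := (A.filter (fun y => 3 * y + K ≤ N)).card
  set Q := (Z.filter (fun y => N < 3 * y + K)).card
  have c2' : (L : ℝ) ≤ 2 * S₀.card + 2 * X.card + R.card + 1 := by exact_mod_cast c2
  have c3' : (S₀.card : ℝ) ≤ (S \ A).card + (Y + Q) := by exact_mod_cast c3
  have hLr : (L : ℝ) = N - 2 * a := by
    rw [hL, Nat.cast_sub ha2.le]
    push_cast
    ring
  have ha1' : (N : ℝ) < 4 * a := by exact_mod_cast ha1
  rcases Nat.le_total (3 * L + K) N with h | h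
  · have hQ : (Q : ℝ) ≤ 2 / 3 := by
      have : 3 * Q ≤ 2 := by omega
      have : (3 * Q : ℝ) ≤ 2 := by exact_mod_cast this
      linarith
    have := min_le_left ((N : ℝ) / 2 - a) ((N : ℝ) / 12 - K / 3)
    linarith
  · have hQ : (3 * Q : ℝ) ≤ 3 * L + K - N + 2 := by
      have : 3 * Q + N ≤ 3 * L + K + 2 := by omega
      have : (3 * Q + N : ℝ) ≤ 3 * L + K + 2 := by exact_mod_cast this
      linarith
    have := min_le_right ((N : ℝ) / 2 - a) ((N : ℝ) / 12 - K / 3)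
    linarith

/-- If every small shift is an almost-period or an almost-antiperiod, the choice between the
two is additive in the shift, and extends to all shifts. -/
lemma exists_parity {S : Finset ℕ} {N K : ℕ} {T : ℝ} (hT : 3 * T < N - K) (hT0 : 0 ≤ T)
    (h : ∀ d, 1 ≤ d → d ≤ K → ((shiftExc S N d True).card : ℝ) ≤ T ∨
      ((shiftExc S N d False).card : ℝ) ≤ T) :
    ∃ c : ℕ, ∀ j d : ℕ, d ≤ j * K →
      ((shiftExc S N d (Even (c * d))).card : ℝ) ≤ j * T := by
  rcases Nat.eq_zero_or_pos K with rfl | hK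
  · refine ⟨0, fun j d hd => ?_⟩
    obtain rfl : d = 0 := by omega
    simp only [mul_zero, Even.zero, card_shiftExc_zero, Nat.cast_zero]
    positivity
  have hone : ∃ c : ℕ, ((shiftExc S N 1 (Even c)).card : ℝ) ≤ T := by
    rcases h 1 le_rfl hK with h | h
    · exact ⟨0, by simpa using h⟩
    · exact ⟨1, by simpa using h⟩
  obtain ⟨c, hc⟩ := hone
  have hsmall : ∀ d ≤ K, ((shiftExc S N d (Even (c * d))).card : ℝ) ≤ T := by
    intro d
    induction d with
    | zero =>
      intro _
      simpa only [mul_zero, Even.zero, card_shiftExc_zero, Nat.cast_zero] using hT0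
    | succ d ih =>
      intro hd
      have h1 := card_shiftExc_add S N d 1 (Even (c * d)) (Even c)
      rw [← Nat.even_add, ← Nat.mul_succ] at h1
      have h2 : ((shiftExc S N (d + 1) (Even (c * (d + 1)))).card : ℝ) ≤ T + T := by
        refine le_trans ?_ (add_le_add (ih (by omega)) hc)
        exact_mod_cast h1
      have h3 : ((shiftExc S N (d + 1) True).card : ℝ) + (shiftExc S N (d + 1) False).card ≥
          N - K := by
        have h4 := card_shiftExc_true_add_false S N (d + 1)
        have h5 : N ≤ (shiftExc S N (d + 1) True).card + (shiftExc S N (d + 1) False).card + K := by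
          omega
        have h6 : (N : ℝ) ≤ (shiftExc S N (d + 1) True).card +
          (shiftExc S N (d + 1) False).card + K := by exact_mod_cast h5
        linarith
      by_cases he : Even (c * (d + 1))
      · simp only [he] at h2 ⊢
        rcases h (d + 1) (by omega) hd with h' | h' <;> linarith
      · simp only [he] at h2 ⊢
        rcases h (d + 1) (by omega) hd with h' | h' <;> linarith
  refine ⟨c, fun j => ?_⟩
  induction j with
  | zero =>
    intro d hd
    obtain rfl : d = 0 := by omega
    simp only [mul_zero, Even.zero, card_shiftExc_zero, Nat.cast_zero, zero_mul, le_refl]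
  | succ j ih =>
    intro d hd
    have hsplit : d = (d - min d K) + min d K := by omega
    have h1 := card_shiftExc_add S N (d - min d K) (min d K) (Even (c * (d - min d K)))
      (Even (c * min d K))
    rw [← Nat.even_add, ← Nat.mul_add, ← hsplit] at h1
    have h2 := ih (d - min d K) (by
      rw [Nat.succ_mul] at hd
      rcases le_total d K with h | h
      · rw [min_eq_left h]; omega
      · rw [min_eq_right h]; omega)
    have h3 := hsmall (min d K) (min_le_right _ _)
    have h4 : ((shiftExc S N d (Even (c * d))).card : ℝ) ≤
        (shiftExc S N (d - min d K) (Even (c * (d - min d K)))).card +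
          (shiftExc S N (min d K) (Even (c * min d K))).card := by exact_mod_cast h1
    push_cast
    linarith

set_option maxHeartbeats 1000000 in
/-- Stability: if `S` is a nearly sum-free subset of `[1, N]` of size nearly `N / 2`, and
`A` is a near-superset of `S` none of whose elements is in many Schur triples with two elements
of `S`, then `A` either has few elements below `N / 2` or consists of odd numbers. -/
theorem sum_free_stability {κ : ℝ} (hκ : 0 < κ) (hκ1 : κ ≤ 1 / 24) {N : ℕ} {t : ℝ}
    (ht : t = (κ ^ 2 / 100000) ^ 2 * N) (ht1 : 1 ≤ t) {S A : Finset ℕ}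
    (hS : S ⊆ Finset.Icc 1 N) (h0 : (N : ℝ) / 2 - t ≤ S.card)
    (h1 : ((S.filter (fun x => N - x ∈ S)).card : ℝ) ≤ t)
    (h2 : ∀ a ∈ A, ((S.filter (fun x => x + a ∈ S)).card : ℝ) ≤ t)
    (hSA : ((S \ A).card : ℝ) ≤ t) :
    ((A.filter (fun a : ℕ => (a : ℝ) ≤ (1 / 2 - κ) * N)).card : ℝ) ≤ κ * N ∨
      ∀ a ∈ A, (a : ℝ) ≤ (1 - κ) * N → Odd a := by
  rw [or_iff_not_imp_left]
  intro hmany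
  push Not at hmany
  obtain ⟨σ, hσ⟩ : ∃ σ : ℝ, σ = κ ^ 2 / 100000 := ⟨_, rfl⟩
  rw [← hσ] at ht
  have hσ0 : 0 < σ := by rw [hσ]; positivity
  have hσκ : 100000 * σ ≤ κ / 24 := by rw [hσ]; nlinarith
  have hN : (0 : ℝ) < N := by
    rcases (Nat.cast_nonneg N : (0 : ℝ) ≤ N).lt_or_eq with h | h
    · exact h
    · rw [← h] at ht; linarith
  have hσN : t ≤ σ * N / 1000 := by
    rw [ht]
    have : σ ^ 2 ≤ σ / 1000 := by nlinarith
    nlinarith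
  have hσκN : 100000 * (σ * N) ≤ κ / 24 * N := by nlinarith
  have hκN : κ * N ≤ N / 24 := by nlinarith
  obtain ⟨K, hK⟩ : ∃ K, K = ⌊κ * N / 8⌋₊ := ⟨_, rfl⟩
  have hKle : (K : ℝ) ≤ κ * N / 8 := by
    rw [hK]
    exact Nat.floor_le (by positivity)
  have hKge : κ * N / 16 ≤ K := by
    have := Nat.lt_floor_add_one (κ * N / 8)
    rw [← hK] at this
    linarith
  have hR := card_reflExc_le hS (by linarith) h0 h1
  have hexc : ∀ a ∈ A, ((shiftExc S N a False).card : ℝ) ≤ 15 * t :=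
    fun a ha => card_shiftExc_false_le ht1 hR (h2 a ha)
  set Y := A.filter (fun y => 3 * y + K ≤ N) with hY
  have hYcard : κ * N / 2 ≤ Y.card := by
    by_cases hex : ∃ a ∈ A, N < 4 * a ∧ (a : ℝ) ≤ (1 / 2 - κ) * N
    · obtain ⟨a, ha, ha1, ha2⟩ := hex
      have hlow := card_le_card_below_third (K := K) ht1 hR hSA ha1 (by
        have : (2 * a : ℝ) < N := by nlinarith
        exact_mod_cast this) (hexc a ha)
      have : κ * N - κ * N / 4 ≤ min ((N : ℝ) / 2 - a) ((N : ℝ) / 12 - K / 3) :=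
        le_min (by linarith) (by linarith)
      linarith
    · push Not at hex
      have hsub : A.filter (fun a : ℕ => (a : ℝ) ≤ (1 / 2 - κ) * N) ⊆ Y := by
        intro a ha
        obtain ⟨haA, ha⟩ := mem_filter.1 ha
        refine mem_filter.2 ⟨haA, ?_⟩
        have h4 : ¬ N < 4 * a := fun h => absurd (hex a haA h) (not_lt.2 ha)
        have h5 : (4 * a : ℝ) ≤ N := by exact_mod_cast not_lt.1 h4
        have h6 : (3 * a + K : ℝ) ≤ N := by linarith
        exact_mod_cast h6
      have h3 : ((A.filter (fun a : ℕ => (a : ℝ) ≤ (1 / 2 - κ) * N)).card : ℝ) ≤ Y.card := by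
        exact_mod_cast card_le_card hsub
      have : 0 < κ * N := by positivity
      linarith
  obtain ⟨q, hq⟩ : ∃ q : ℝ, q = 16 * σ * N := ⟨_, rfl⟩
  have hq0 : 0 < q := by rw [hq]; positivity
  obtain ⟨T, hT⟩ : ∃ T : ℝ, T = 90 * t + 4 * q := ⟨_, rfl⟩
  have hTle : T ≤ 70 * (σ * N) := by
    rw [hT, hq]
    nlinarith
  have hbad := card_bad_translations_le (q := q) hS ht1 hexc hSA
  set U := (Finset.Icc 1 N \ S).filter (fun w => q ≤ (escaping S N w).card) with hU
  have hUcard : (U.card : ℝ) ≤ σ * N := by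
    have h3 : q * U.card ≤ q * (σ * N) := by
      refine hbad.trans (le_of_eq ?_)
      rw [hq, ht]
      ring
    exact le_of_mul_le_mul_left h3 hq0
  have hdich : ∀ d, 1 ≤ d → d ≤ K → ((shiftExc S N d True).card : ℝ) ≤ T ∨
      ((shiftExc S N d False).card : ℝ) ≤ T := by
    intro d _ hd
    by_cases hper : ∃ y ∈ Y, y + d ∈ A
    · left
      obtain ⟨y, hy, hyd⟩ := hper
      obtain ⟨hyA, hyN⟩ := mem_filter.1 hy
      have h3 := card_shiftExc_sub S N y d (by omega)
      have h4 : ((shiftExc S N d True).card : ℝ) ≤ 2 * ((shiftExc S N y False).card +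
        (shiftExc S N (y + d) False).card) := by exact_mod_cast h3
      have h5 := hexc y hyA
      have h6 := hexc _ hyd
      have : 0 ≤ q := by positivity
      linarith
    · right
      push Not at hper
      obtain ⟨y, hy, hyd⟩ : ∃ y ∈ Y, y + d ∉ (S \ A) ∪ U := by
        by_contra hcon
        push Not at hcon
        have h3 : Y.card ≤ ((S \ A) ∪ U).card := by
          refine card_le_card_of_injOn (fun y => y + d) (fun y hy => hcon y hy) ?_
          intro a _ b _ hab
          exact Nat.add_right_cancel hab
        have h4 : (Y.card : ℝ) ≤ (S \ A).card + U.card := by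
          exact_mod_cast h3.trans (card_union_le _ _)
        linarith
      obtain ⟨hyA, hyN⟩ := mem_filter.1 hy
      rw [mem_union, not_or] at hyd
      have hydS : y + d ∉ S := fun h => hyd.1 (mem_sdiff.2 ⟨h, hper y hy⟩)
      have hesc : ((escaping S N (y + d)).card : ℝ) ≤ q := by
        by_contra h
        refine hyd.2 (mem_filter.2 ⟨mem_sdiff.2 ⟨mem_Icc.2 ⟨by omega, by omega⟩, hydS⟩, ?_⟩)
        exact (not_le.1 h).le
      have h3 := card_shiftExc_of_escaping S N y d (by omega)
      have h4 : ((shiftExc S N d False).card : ℝ) ≤ 6 * (shiftExc S N y False).card +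
        4 * (escaping S N (y + d)).card := by exact_mod_cast h3
      have h5 := hexc y hyA
      linarith
  obtain ⟨c, hc⟩ := exists_parity (by linarith) (by rw [hT]; positivity) hdich
  intro a ha haN
  obtain ⟨j, hj⟩ : ∃ j, j = ⌈16 / κ⌉₊ := ⟨_, rfl⟩
  have hj1 : 16 / κ ≤ j := hj ▸ Nat.le_ceil _
  have hj2 : (j : ℝ) ≤ 17 / κ := by
    have h3 := (Nat.ceil_lt_add_one (by positivity : 0 ≤ 16 / κ)).le
    rw [← hj] at h3
    have h4 : 1 ≤ 1 / κ := by rw [le_div_iff₀ hκ]; linarith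
    have h5 : 17 / κ = 16 / κ + 1 / κ := by ring
    linarith
  have hjK : N ≤ j * K := by
    have h3 : (N : ℝ) ≤ j * K := by
      calc (N : ℝ) = 16 / κ * (κ * N / 16) := by field_simp
        _ ≤ j * K := mul_le_mul hj1 hKge (by positivity) (by positivity)
    exact_mod_cast h3
  have haN' : a ≤ N := by
    have : (a : ℝ) ≤ N := by nlinarith
    exact_mod_cast this
  have h3 := hc j a (haN'.trans hjK)
  have h4 := hexc a ha
  have h5 : j * T ≤ κ * N / 2 := by
    calc j * T ≤ 17 / κ * (70 * (σ * N)) := mul_le_mul hj2 hTle (by rw [hT]; positivity)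
          (by positivity)
      _ = 1190 / 100000 * (κ * N) := by rw [hσ]; field_simp; ring
      _ ≤ κ * N / 2 := by nlinarith
  rw [← Nat.not_even_iff_odd]
  intro heven
  simp only [heven.mul_left c] at h3
  have h6 := card_shiftExc_true_add_false S N a
  have h7 : N ≤ (shiftExc S N a True).card + (shiftExc S N a False).card + a := by omega
  have h8 : (N : ℝ) ≤ (shiftExc S N a True).card + (shiftExc S N a False).card + a := by
    exact_mod_cast h7
  have : 0 < κ * N := by positivity
  nlinarith

/-- Markov's inequality for counts. -/
lemma card_filter_lt_le_of_sum_le {α : Type*} {s : Finset α} {f : α → ℕ} {b : ℝ} (hb : 0 < b)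
    (h : ((∑ a ∈ s, f a : ℕ) : ℝ) ≤ b ^ 2) :
    ((s.filter (fun a => b < f a)).card : ℝ) ≤ b := by
  have h1 : (s.filter (fun a => b < f a)).card • b ≤
      ∑ a ∈ s.filter (fun a => b < f a), (f a : ℝ) :=
    card_nsmul_le_sum _ _ _ fun a ha => (mem_filter.1 ha).2.le
  have h2 : ∑ a ∈ s.filter (fun a => b < f a), (f a : ℝ) ≤ ∑ a ∈ s, (f a : ℝ) :=
    sum_le_sum_of_subset_of_nonneg (filter_subset _ _) fun _ _ _ => Nat.cast_nonneg _
  rw [nsmul_eq_mul] at h1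
  push_cast at h
  nlinarith

lemma card_filter_lt_Icc_le {M : ℕ} {a : ℝ} (ha0 : 0 ≤ a) (ha : a ≤ M + 1) :
    (((Finset.Icc 1 M).filter (fun x : ℕ => a < x)).card : ℝ) ≤ M - a + 1 := by
  have hsub : (Finset.Icc 1 M).filter (fun x : ℕ => a < x) ⊆ Finset.Ioc ⌊a⌋₊ M := by
    intro x hx
    obtain ⟨hx1, hx2⟩ := mem_filter.1 hx
    exact mem_Ioc.2 ⟨(Nat.floor_lt ha0).2 hx2, (mem_Icc.1 hx1).2⟩
  have h1 := card_le_card hsub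
  rw [Nat.card_Ioc] at h1
  have h2 := Nat.lt_floor_add_one a
  rcases le_total ⌊a⌋₊ M with h | h
  · have h3 : (((Finset.Icc 1 M).filter (fun x : ℕ => a < x)).card : ℝ) + ⌊a⌋₊ ≤ M := by
      exact_mod_cast (by omega : _ + ⌊a⌋₊ ≤ M)
    linarith
  · have h3 : ((Finset.Icc 1 M).filter (fun x : ℕ => a < x)).card = 0 := by omega
    rw [h3]
    push_cast
    linarith

/-- A set of integers in `[1, m]` meeting its reflection in few points has about at most half
of the elements. -/
lemma two_mul_card_le_of_reflection {X : Finset ℕ} {m : ℕ} (hX : X ⊆ Finset.Icc 1 m) :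
    2 * X.card ≤ m + 1 + (X.filter (fun x => m - x ∈ X)).card := by
  have h1 : (X.erase m).card ≤ (X.filter (fun x => m - x ∈ X)).card +
      ((X.erase m).filter (fun x => m - x ∉ X)).card := by
    rw [← card_filter_add_card_filter_not (s := X.erase m) (fun x => m - x ∈ X)]
    exact Nat.add_le_add_right (card_le_card (filter_subset_filter _ (erase_subset _ _))) _
  have h2 : ((X.erase m).filter (fun x => m - x ∉ X)).card ≤
      ((Finset.Icc 1 (m - 1)) \ X).card := by
    refine card_le_card_of_injOn (fun x => m - x) ?_ ?_
    · intro x hx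
      simp only [coe_filter, mem_erase, Set.mem_ofPred_eq] at hx
      have h3 := mem_Icc.1 (hX hx.1.2)
      have h4 := hx.1.1
      have h5 : 1 ≤ m - x ∧ m - x ≤ m - 1 := by omega
      exact mem_sdiff.2 ⟨mem_Icc.2 h5, hx.2⟩
    · intro x hx y hy hxy
      simp only [coe_filter, mem_erase, Set.mem_ofPred_eq] at hx hy
      have h3 := mem_Icc.1 (hX hx.1.2)
      have h4 := mem_Icc.1 (hX hy.1.2)
      simp only at hxy
      omega
  have h3 : ((Finset.Icc 1 (m - 1)) \ X).card + (X.erase m).card ≤ m - 1 := by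
    have h4 : ((Finset.Icc 1 (m - 1)) \ X).card + (X.erase m).card =
        (((Finset.Icc 1 (m - 1)) \ X) ∪ X.erase m).card := by
      refine (card_union_of_disjoint ?_).symm
      exact disjoint_sdiff_self_left.mono_right (erase_subset _ _)
    rw [h4]
    refine (card_le_card (union_subset sdiff_subset ?_)).trans (Nat.card_Icc 1 (m - 1)).le
    intro x hx
    obtain ⟨hx1, hx2⟩ := mem_erase.1 hx
    have := mem_Icc.1 (hX hx2)
    exact mem_Icc.2 ⟨by omega, by omega⟩
  have h4 := pred_card_le_card_erase (s := X) (a := m)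
  rcases Nat.eq_zero_or_pos m with rfl | hm
  · have := card_le_card hX
    simp at this
    simp [this]
  · omega

lemma card_symmDiff_le_of_card_sdiff_le {A X : Finset ℕ} {a b c : ℝ} (hA : a ≤ A.card)
    (hX : (X.card : ℝ) ≤ b) (h : ((A \ X).card : ℝ) ≤ c) :
    ((symmDiff A X).card : ℝ) ≤ 2 * c + (b - a) := by
  have h1 : (symmDiff A X).card ≤ (A \ X).card + (X \ A).card := card_union_le _ _
  have h2 : (X \ A).card + A.card = (A \ X).card + X.card := by
    rw [card_sdiff_add_card, card_sdiff_add_card, union_comm]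
  have h3 : ((symmDiff A X).card : ℝ) ≤ (A \ X).card + (X \ A).card := by exact_mod_cast h1
  have h4 : ((X \ A).card : ℝ) + A.card = (A \ X).card + X.card := by exact_mod_cast h2
  linarith

lemma card_odd_Icc_le (n : ℕ) :
    (((Finset.Icc 1 n).filter (fun x => Odd x)).card : ℝ) ≤ (n : ℝ) / 2 + 1 := by
  have h1 : ((Finset.Icc 1 n).filter (fun x => Odd x)).card ≤ (Finset.range (n / 2 + 1)).card := by
    refine card_le_card_of_injOn (fun x => x / 2) ?_ ?_
    · intro x hx
      have := mem_Icc.1 (mem_filter.1 hx).1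
      simp only [coe_range, Set.mem_Iio]
      omega
    · intro x hx y hy hxy
      obtain ⟨k, hk⟩ := (mem_filter.1 hx).2
      obtain ⟨l, hl⟩ := (mem_filter.1 hy).2
      simp only at hxy
      omega
  rw [card_range] at h1
  have h2 : 2 * ((Finset.Icc 1 n).filter (fun x => Odd x)).card ≤ n + 2 := by omega
  have h3 : 2 * (((Finset.Icc 1 n).filter (fun x => Odd x)).card : ℝ) ≤ n + 2 := by
    exact_mod_cast h2
  linarith

lemma card_upper_half_le (n : ℕ) :
    ((Finset.Icc (n / 2 + 1) n).card : ℝ) ≤ (n : ℝ) / 2 + 1 := by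
  have h2 : 2 * (Finset.Icc (n / 2 + 1) n).card ≤ n + 2 := by
    rw [Nat.card_Icc]
    omega
  have h3 : 2 * ((Finset.Icc (n / 2 + 1) n).card : ℝ) ≤ n + 2 := by exact_mod_cast h2
  linarith

/-- If few elements of `C` are in more than `b` sums of two elements of `B ⊇ C`, then there is
a threshold `m` governing the sizes of `B` and `C`. -/
lemma exists_threshold {n : ℕ} {b : ℝ} (hb : 1 ≤ b) {B C : Finset ℕ}
    (hB : B ⊆ Finset.Icc 1 n) (hCB : C ⊆ B)
    (hbad : ((C.filter (fun c => b < (B.filter (fun x => c - x ∈ B)).card)).card : ℝ) ≤ b) :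
    ∃ m ≤ n, (m ≠ 0 → ((B.filter (fun x => m - x ∈ B)).card : ℝ) ≤ b) ∧
      ((C.filter (fun c => m < c)).card : ℝ) ≤ b ∧
      (B.card : ℝ) ≤ n - m / 2 + b ∧ (C.card : ℝ) ≤ m / 2 + 2 * b := by
  obtain ⟨m, hmn, hm, htop⟩ : ∃ m ≤ n,
      (m ≠ 0 → ((B.filter (fun x => m - x ∈ B)).card : ℝ) ≤ b) ∧
      ∀ c ∈ C, m < c → b < (B.filter (fun x => c - x ∈ B)).card := by
    by_cases hne : (C.filter (fun c => ((B.filter (fun x => c - x ∈ B)).card : ℝ) ≤ b)).Nonempty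
    · obtain ⟨m, hm, hmax⟩ := exists_max_image _ (fun c => c) hne
      obtain ⟨hmC, hmb⟩ := mem_filter.1 hm
      refine ⟨m, (mem_Icc.1 (hB (hCB hmC))).2, fun _ => hmb, fun c hc hmc => ?_⟩
      by_contra hcon
      exact absurd (hmax c (mem_filter.2 ⟨hc, not_lt.1 hcon⟩)) (not_le.2 hmc)
    · rw [not_nonempty_iff_eq_empty, filter_eq_empty_iff] at hne
      exact ⟨0, Nat.zero_le _, fun h => absurd rfl h, fun c hc _ => not_le.1 (hne hc)⟩
  have hCtop : ((C.filter (fun c => m < c)).card : ℝ) ≤ b := by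
    refine le_trans ?_ hbad
    exact_mod_cast card_le_card fun c hc => by
      obtain ⟨hcC, hmc⟩ := mem_filter.1 hc
      exact mem_filter.2 ⟨hcC, htop c hcC hmc⟩
  have hlow : ((B.filter (fun x => x ≤ m)).card : ℝ) ≤ m / 2 + b := by
    rcases Nat.eq_zero_or_pos m with rfl | hm0
    · have : B.filter (fun x => x ≤ 0) = ∅ := by
        rw [filter_eq_empty_iff]
        intro x hx
        have := (mem_Icc.1 (hB hx)).1
        omega
      rw [this]
      simp only [card_empty, Nat.cast_zero]
      linarith
    · have h1 : 2 * (B.filter (fun x => x ≤ m)).card ≤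
          m + 1 + (B.filter (fun x => m - x ∈ B)).card := by
        refine (two_mul_card_le_of_reflection (m := m) ?_).trans ?_
        · intro x hx
          obtain ⟨hx1, hx2⟩ := mem_filter.1 hx
          exact mem_Icc.2 ⟨(mem_Icc.1 (hB hx1)).1, hx2⟩
        · refine Nat.add_le_add_left (card_le_card fun x hx => ?_) _
          obtain ⟨hx1, hx2⟩ := mem_filter.1 hx
          exact mem_filter.2 ⟨(mem_filter.1 hx1).1, (mem_filter.1 hx2).1⟩
      have h2 : 2 * ((B.filter (fun x => x ≤ m)).card : ℝ) ≤
          m + 1 + (B.filter (fun x => m - x ∈ B)).card := by exact_mod_cast h1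
      have h3 := hm hm0.ne'
      linarith
  refine ⟨m, hmn, hm, hCtop, ?_, ?_⟩
  · have h1 : (B.filter (fun x => ¬ x ≤ m)).card ≤ n - m := by
      rw [← Nat.card_Ioc]
      refine card_le_card fun x hx => ?_
      obtain ⟨hx1, hx2⟩ := mem_filter.1 hx
      exact mem_Ioc.2 ⟨not_le.1 hx2, (mem_Icc.1 (hB hx1)).2⟩
    have h2 := card_filter_add_card_filter_not (s := B) (fun x => x ≤ m)
    have h3 : B.card + m ≤ (B.filter (fun x => x ≤ m)).card + n := by omega
    have h4 : (B.card : ℝ) + m ≤ (B.filter (fun x => x ≤ m)).card + n := by exact_mod_cast h3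
    linarith
  · have h1 : C.card ≤ (B.filter (fun x => x ≤ m)).card + (C.filter (fun c => m < c)).card := by
      rw [← card_filter_add_card_filter_not (s := C) (fun x => x ≤ m)]
      simp only [not_le]
      exact Nat.add_le_add_right (card_le_card (filter_subset_filter _ hCB)) _
    have h2 : (C.card : ℝ) ≤ (B.filter (fun x => x ≤ m)).card +
        (C.filter (fun c => m < c)).card := by exact_mod_cast h1
    linarith

/-- If the weight of the threshold structure is nearly extremal, then `m` is nearly `n` and
`C` has nearly `n / 2` elements. -/
lemma threshold_bounds {l L n m B C τ ρ : ℝ} (hl : 1 / 2 ≤ l) (hL : 2 * l < L) (hτ : 0 < τ)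
    (hn : 0 ≤ n) (hρ : ρ = 2 * τ * (1 + 2 * L) / (L - 2 * l))
    (hB : B ≤ n - m / 2 + τ * n) (hC : C ≤ m / 2 + 2 * (τ * n))
    (hW : n / 2 * L - τ * n ≤ B * l + C * (L - l)) :
    4 * τ ≤ ρ ∧ n - m ≤ ρ * n ∧ n / 2 - 2 * ρ * n ≤ C := by
  have hLl : 0 < L - 2 * l := by linarith
  have hρ' : ρ * (L - 2 * l) = 2 * τ * (1 + 2 * L) := by
    rw [hρ]
    field_simp
  have hτρ : 4 * τ ≤ ρ := by
    rw [hρ, le_div_iff₀ hLl]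
    nlinarith
  have h1 : B * l ≤ (n - m / 2 + τ * n) * l := mul_le_mul_of_nonneg_right hB (by linarith)
  have h2 : C * (L - l) ≤ (m / 2 + 2 * (τ * n)) * (L - l) :=
    mul_le_mul_of_nonneg_right hC (by linarith)
  have hτn : 0 ≤ τ * n := by positivity
  have h3 : (n - m) * (L - 2 * l) ≤ ρ * n * (L - 2 * l) := by
    have : ρ * n * (L - 2 * l) = 2 * (τ * n) * (1 + 2 * L) := by linear_combination n * hρ'
    rw [this]
    nlinarith
  have h4 : n - m ≤ ρ * n := le_of_mul_le_mul_right h3 hLl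
  refine ⟨hτρ, h4, ?_⟩
  have h5 : (n / 2 - 2 * ρ * n) * (L - l) ≤ C * (L - l) := by
    have h6 : B * l ≤ (n / 2 + ρ * n / 2 + τ * n) * l :=
      mul_le_mul_of_nonneg_right (by linarith) (by linarith)
    have h7 : 4 * (τ * n) ≤ ρ * n := by nlinarith
    have h8 : 0 ≤ ρ * n := by linarith
    have h9 : ρ * n * l ≤ ρ * n * (L - l) := mul_le_mul_of_nonneg_left (by linarith) h8
    have h10 : τ * n * l ≤ ρ * n / 4 * l := mul_le_mul_of_nonneg_right (by linarith) (by linarith)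
    have h11 : ρ * n * (1 / 2) ≤ ρ * n * l := mul_le_mul_of_nonneg_left hl h8
    nlinarith
  exact le_of_mul_le_mul_right h5 (by linarith)

/-- The conclusion about `A` obtained from `sum_free_stability` applied below the threshold. -/
lemma card_sdiff_le_of_stability {n m : ℕ} {b κ ρ : ℝ} (hb : 1 ≤ b) (hκ : 0 < κ)
    (hκ1 : κ ≤ 1 / 24) (hbρ : 4 * b ≤ ρ * n) (hmn : m ≤ n)
    (hm : (n : ℝ) - m ≤ ρ * n) {A A' : Finset ℕ} (hA : A ⊆ Finset.Icc 1 n)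
    (hAA' : ((A \ A').card : ℝ) ≤ b)
    (h : ((A'.filter (fun a : ℕ => (a : ℝ) ≤ (1 / 2 - κ) * m)).card : ℝ) ≤ κ * m ∨
      ∀ a ∈ A', (a : ℝ) ≤ (1 - κ) * m → Odd a) :
    ((A \ (Finset.Icc 1 n).filter (fun x => Odd x)).card : ℝ) ≤ 2 * κ * n + 2 * ρ * n ∨
      ((A \ Finset.Icc (n / 2 + 1) n).card : ℝ) ≤ 2 * κ * n + 2 * ρ * n := by
  have hmn' : (m : ℝ) ≤ n := by exact_mod_cast hmn
  have hm0 : (0 : ℝ) ≤ m := Nat.cast_nonneg m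
  have hn0 : (0 : ℝ) ≤ n := Nat.cast_nonneg n
  have hκm : κ * m ≤ κ * n := mul_le_mul_of_nonneg_left hmn' hκ.le
  rcases h with h | h
  · right
    have hsub : A \ Finset.Icc (n / 2 + 1) n ⊆
        (A \ A' ∪ A'.filter (fun a : ℕ => (a : ℝ) ≤ (1 / 2 - κ) * m)) ∪
          (Finset.Icc 1 (n / 2)).filter (fun x : ℕ => (1 / 2 - κ) * m < x) := by
      intro a ha
      obtain ⟨haA, haI⟩ := mem_sdiff.1 ha
      have ha1 := mem_Icc.1 (hA haA)
      have ha2 : a ≤ n / 2 := by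
        by_contra hcon
        exact haI (mem_Icc.2 ⟨not_le.1 hcon, ha1.2⟩)
      rw [mem_union, mem_union, mem_sdiff, mem_filter, mem_filter]
      by_cases h1 : a ∈ A'
      · rcases le_or_gt (a : ℝ) ((1 / 2 - κ) * m) with h2 | h2
        · exact Or.inl (Or.inr ⟨h1, h2⟩)
        · exact Or.inr ⟨mem_Icc.2 ⟨ha1.1, ha2⟩, h2⟩
      · exact Or.inl (Or.inl ⟨haA, h1⟩)
    have hcard : ((A \ Finset.Icc (n / 2 + 1) n).card : ℝ) ≤ (A \ A').card +
        (A'.filter (fun a : ℕ => (a : ℝ) ≤ (1 / 2 - κ) * m)).card +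
          ((Finset.Icc 1 (n / 2)).filter (fun x : ℕ => (1 / 2 - κ) * m < x)).card := by
      exact_mod_cast (card_le_card hsub).trans ((card_union_le _ _).trans
        (Nat.add_le_add_right (card_union_le _ _) _))
    have hhalf : ((n / 2 : ℕ) : ℝ) ≤ n / 2 := Nat.cast_div_le
    have hhalf' : (n : ℝ) ≤ 2 * (n / 2 : ℕ) + 1 := by
      exact_mod_cast (by omega : n ≤ 2 * (n / 2) + 1)
    have hcount := card_filter_lt_Icc_le (M := n / 2) (a := (1 / 2 - κ) * m)
      (mul_nonneg (by linarith) hm0) (by nlinarith)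
    nlinarith
  · left
    have hsub : A \ (Finset.Icc 1 n).filter (fun x => Odd x) ⊆
        A \ A' ∪ (Finset.Icc 1 n).filter (fun x : ℕ => (1 - κ) * m < x) := by
      intro a ha
      obtain ⟨haA, haO⟩ := mem_sdiff.1 ha
      rw [mem_union, mem_sdiff, mem_filter]
      by_cases h1 : a ∈ A'
      · refine Or.inr ⟨hA haA, ?_⟩
        by_contra hcon
        exact haO (mem_filter.2 ⟨hA haA, h a h1 (not_lt.1 hcon)⟩)
      · exact Or.inl ⟨haA, h1⟩
    have hcard : ((A \ (Finset.Icc 1 n).filter (fun x => Odd x)).card : ℝ) ≤ (A \ A').card +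
        ((Finset.Icc 1 n).filter (fun x : ℕ => (1 - κ) * m < x)).card := by
      exact_mod_cast (card_le_card hsub).trans (card_union_le _ _)
    have hcount := card_filter_lt_Icc_le (M := n) (a := (1 - κ) * m)
      (mul_nonneg (by linarith) hm0) (by nlinarith)
    nlinarith

/-- Sets with few Schur triples whose weight is nearly extremal are close to the odd numbers
or to the upper half. -/
theorem structure_of_weights {r : ℕ} (hr : 5 ≤ r) {ε : ℝ} (hε : 0 < ε) :
    ∃ τ : ℝ, 0 < τ ∧ ∀ n : ℕ, 1 ≤ τ * n → ∀ A B C : Finset ℕ,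
      A ⊆ Finset.Icc 1 n → B ⊆ A → C ⊆ B →
      (n : ℝ) / 2 * Real.log r - τ * n ≤
        B.card * Real.log 2 + C.card * (Real.log r - Real.log 2) →
      ((∑ c ∈ C, (B.filter (fun x => c - x ∈ B)).card : ℕ) : ℝ) ≤ (τ * n) ^ 2 →
      ((∑ a ∈ A, (C.filter (fun x => x + a ∈ C)).card : ℕ) : ℝ) ≤ (τ * n) ^ 2 →
      ((symmDiff A ((Finset.Icc 1 n).filter (fun x => Odd x))).card : ℝ) ≤ ε * n ∨
      ((symmDiff A (Finset.Icc (n / 2 + 1) n)).card : ℝ) ≤ ε * n := by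
  have hl : 1 / 2 ≤ Real.log 2 := by linarith [Real.log_two_gt_d9]
  have hL : 2 * Real.log 2 < Real.log r := by
    have h4 : 2 * Real.log 2 = Real.log 4 := by
      rw [show (4 : ℝ) = 2 ^ 2 by norm_num, Real.log_pow]
      norm_num
    rw [h4]
    refine Real.log_lt_log (by norm_num) ?_
    exact_mod_cast (by omega : 4 < r)
  obtain ⟨κ, hκ, hκ1, hκε⟩ : ∃ κ : ℝ, 0 < κ ∧ κ ≤ 1 / 24 ∧ κ ≤ ε / 8 :=
    ⟨min (1 / 24) (ε / 8), lt_min (by norm_num) (by positivity), min_le_left _ _,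
      min_le_right _ _⟩
  obtain ⟨s, hs⟩ : ∃ s : ℝ, s = (κ ^ 2 / 100000) ^ 2 := ⟨_, rfl⟩
  have hs0 : 0 < s := by rw [hs]; positivity
  have hsκ : s ≤ κ / 14 := by
    have h1 : κ ^ 2 / 100000 ≤ κ / 14 := by nlinarith
    have h2 : κ ^ 2 / 100000 ≤ 1 := by linarith
    have h3 : 0 ≤ κ ^ 2 / 100000 := by positivity
    rw [hs]
    nlinarith
  obtain ⟨ρ, hρs⟩ : ∃ ρ : ℝ, ρ = s / 6 := ⟨_, rfl⟩
  obtain ⟨τ, hτ⟩ : ∃ τ : ℝ, τ = ρ * (Real.log r - 2 * Real.log 2) / (2 * (1 + 2 * Real.log r)) :=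
    ⟨_, rfl⟩
  have hLl : 0 < Real.log r - 2 * Real.log 2 := by linarith
  have hL0 : 0 < 1 + 2 * Real.log r := by linarith
  have hτ0 : 0 < τ := by
    rw [hτ, hρs]
    positivity
  have hρτ : ρ = 2 * τ * (1 + 2 * Real.log r) / (Real.log r - 2 * Real.log 2) := by
    rw [hτ]
    field_simp
  refine ⟨τ, hτ0, fun n hn A B C hA hBA hCB hW hQB hQC => ?_⟩
  have hb0 : 0 < τ * n := by linarith
  obtain ⟨m, hmn, hmB, hCm, hBcard, hCcard⟩ :=
    exists_threshold hn (hBA.trans hA) hCB (card_filter_lt_le_of_sum_le hb0 hQB)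
  obtain ⟨hτρ, hmρ, hClow⟩ := threshold_bounds hl hL hτ0 (Nat.cast_nonneg n) hρτ hBcard hCcard hW
  have hbρ : 4 * (τ * n) ≤ ρ * n := by
    have := mul_le_mul_of_nonneg_right hτρ (Nat.cast_nonneg (α := ℝ) n)
    linarith
  have hn0 : (0 : ℝ) < n := by
    by_contra h
    have h1 : (n : ℝ) = 0 := le_antisymm (not_lt.1 h) (Nat.cast_nonneg n)
    rw [h1] at hb0
    linarith
  have hmn' : (m : ℝ) ≤ n := by exact_mod_cast hmn
  have hm2 : (n : ℝ) / 2 ≤ m := by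
    have : ρ * n ≤ 1 / 2 * n := mul_le_mul_of_nonneg_right (by linarith) hn0.le
    linarith
  have hm0 : m ≠ 0 := by
    rintro rfl
    push_cast at hm2
    linarith
  have hts : 3 * (ρ * n) ≤ s * m := by
    rw [hρs]
    nlinarith
  have hbt : τ * n ≤ s * m := by linarith
  obtain ⟨A', hA'⟩ : ∃ A', A' = A.filter
      (fun a => ((C.filter (fun x => x + a ∈ C)).card : ℝ) ≤ τ * n) := ⟨_, rfl⟩
  have hAA' : ((A \ A').card : ℝ) ≤ τ * n := by
    rw [hA', ← filter_not]
    simp only [not_le]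
    exact card_filter_lt_le_of_sum_le hb0 hQC
  obtain ⟨S, hS⟩ : ∃ S, S = C.filter (fun c => c ≤ m) := ⟨_, rfl⟩
  have hSC : S ⊆ C := hS ▸ filter_subset _ _
  have hScard : (C.card : ℝ) ≤ S.card + τ * n := by
    have h1 := card_filter_add_card_filter_not (s := C) (fun c => c ≤ m)
    simp only [not_le] at h1
    rw [← hS] at h1
    have h2 : (S.card : ℝ) + (C.filter (fun c => m < c)).card = C.card := by exact_mod_cast h1
    linarith
  have hstab := sum_free_stability hκ hκ1 (N := m) (t := s * m) (by rw [hs]) (by linarith)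
    (S := S) (A := A')
    (fun x hx => by
      rw [hS] at hx
      obtain ⟨hx1, hx2⟩ := mem_filter.1 hx
      exact mem_Icc.2 ⟨(mem_Icc.1 (hA (hBA (hCB hx1)))).1, hx2⟩)
    (by linarith)
    (by
      refine le_trans ?_ ((hmB hm0).trans hbt)
      exact_mod_cast card_le_card fun x hx => by
        obtain ⟨hx1, hx2⟩ := mem_filter.1 hx
        exact mem_filter.2 ⟨hCB (hSC hx1), hCB (hSC hx2)⟩)
    (fun a ha => by
      rw [hA'] at ha
      refine le_trans ?_ ((mem_filter.1 ha).2.trans hbt)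
      exact_mod_cast card_le_card fun x hx => by
        obtain ⟨hx1, hx2⟩ := mem_filter.1 hx
        exact mem_filter.2 ⟨hSC hx1, hSC hx2⟩)
    (by
      refine le_trans ?_ (hAA'.trans hbt)
      exact_mod_cast card_le_card
        (sdiff_subset_sdiff (hSC.trans (hCB.trans hBA)) (Subset.refl A')))
  have hAC : (n : ℝ) / 2 - 2 * ρ * n ≤ A.card := by
    refine hClow.trans ?_
    exact_mod_cast card_le_card (hCB.trans hBA)
  have hfin : 2 * (2 * κ * n + 2 * ρ * n) + ((n : ℝ) / 2 + 1 - (n / 2 - 2 * ρ * n)) ≤ ε * n := by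
    have h1 : κ * n ≤ ε / 8 * n := mul_le_mul_of_nonneg_right hκε hn0.le
    have h2 : 14 * (ρ * n) ≤ κ * n := by
      have : 14 * ρ * n ≤ κ * n := mul_le_mul_of_nonneg_right (by linarith) hn0.le
      linarith
    linarith
  rcases card_sdiff_le_of_stability hn hκ hκ1 hbρ hmn hmρ hA hAA' hstab with h | h
  · exact Or.inl ((card_symmDiff_le_of_card_sdiff_le hAC (card_odd_Icc_le n) h).trans hfin)
  · exact Or.inr ((card_symmDiff_le_of_card_sdiff_le hAC (card_upper_half_le n) h).trans hfin)

/-- Coloured integers forming a rainbow Schur triple, in any order. -/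
def RainbowTriple {r : ℕ} (u v w : ℕ × Fin r) : Prop :=
  (u.1 + v.1 = w.1 ∨ u.1 + w.1 = v.1 ∨ v.1 + w.1 = u.1) ∧
    u.2 ≠ v.2 ∧ u.2 ≠ w.2 ∧ v.2 ≠ w.2

lemma RainbowTriple.swap {r : ℕ} {u v w : ℕ × Fin r} (h : RainbowTriple u v w) :
    RainbowTriple u w v := by
  obtain ⟨h1, h2, h3, h4⟩ := h
  exact ⟨by omega, h3, h2, h4.symm⟩

lemma RainbowTriple.rotate {r : ℕ} {u v w : ℕ × Fin r} (h : RainbowTriple u v w) :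
    RainbowTriple v w u := by
  obtain ⟨h1, h2, h3, h4⟩ := h
  exact ⟨by omega, h4, h2.symm, h3.symm⟩

open Classical in
lemma card_rainbowTriple_le {r : ℕ} (C : Finset (ℕ × Fin r)) (u v : ℕ × Fin r) :
    (C.filter (RainbowTriple u v)).card ≤ 3 * r := by
  have hsub : C.filter (RainbowTriple u v) ⊆
      ({u.1 + v.1, v.1 - u.1, u.1 - v.1} : Finset ℕ) ×ˢ (univ : Finset (Fin r)) := by
    intro w hw
    have h := (mem_filter.1 hw).2.1
    simp only [mem_product, mem_insert, mem_singleton, mem_univ, and_true]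
    omega
  refine (card_le_card hsub).trans ?_
  rw [card_product, card_univ, Fintype.card_fin]
  exact Nat.mul_le_mul_right _ card_le_three

open Classical in
lemma card_rainbowTriple_left_le {r : ℕ} (C : Finset (ℕ × Fin r)) (v w : ℕ × Fin r) :
    (C.filter (fun u => RainbowTriple u v w)).card ≤ 3 * r := by
  refine (card_le_card fun u hu => ?_).trans (card_rainbowTriple_le C v w)
  exact mem_filter.2 ⟨(mem_filter.1 hu).1, (mem_filter.1 hu).2.rotate⟩

/-- The colours that a set of coloured integers allows at `x`. -/
def palette {r : ℕ} (P : Finset (ℕ × Fin r)) (x : ℕ) : Finset (Fin r) :=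
  univ.filter (fun i => (x, i) ∈ P)

lemma mem_palette {r : ℕ} {P : Finset (ℕ × Fin r)} {x : ℕ} {i : Fin r} :
    i ∈ palette P x ↔ (x, i) ∈ P := by
  simp [palette]

lemma numRSF_le_sum_prod_palette {r : ℕ} {A : Finset ℕ} {F : Finset (Finset (ℕ × Fin r))}
    (hF : ∀ I ⊆ A ×ˢ (univ : Finset (Fin r)), EdgeFree RainbowTriple I → ∃ D ∈ F, I ⊆ D) :
    numRSF r A ≤ ∑ P ∈ F, ∏ x ∈ A, (palette P x).card := by
  classical
  rw [numRSF, Nat.card_eq_fintype_card, Fintype.card_subtype]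
  have hsub : (univ.filter (fun f : ↥A → Fin r => ∀ x y z : ↥A, (x : ℕ) + (y : ℕ) = (z : ℕ) →
      ¬(f x ≠ f y ∧ f x ≠ f z ∧ f y ≠ f z))) ⊆
      F.biUnion fun P => Fintype.piFinset fun x : ↥A => palette P x := by
    intro f hf
    have hf := (mem_filter.1 hf).2
    obtain ⟨D, hD, hID⟩ := hF (univ.image fun x : ↥A => ((x : ℕ), f x)) (by
      intro u hu
      obtain ⟨x, -, rfl⟩ := mem_image.1 hu
      exact mem_product.2 ⟨x.2, mem_univ _⟩) (by
      intro u hu v hv w hw h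
      obtain ⟨x, -, rfl⟩ := mem_image.1 hu
      obtain ⟨y, -, rfl⟩ := mem_image.1 hv
      obtain ⟨z, -, rfl⟩ := mem_image.1 hw
      obtain ⟨h1, h2, h3, h4⟩ := h
      rcases h1 with h1 | h1 | h1
      · exact hf x y z h1 ⟨h2, h3, h4⟩
      · exact hf x z y h1 ⟨h3, h2, h4.symm⟩
      · exact hf y z x h1 ⟨h4, h2.symm, h3.symm⟩)
    refine mem_biUnion.2 ⟨D, hD, Fintype.mem_piFinset.2 fun x => mem_palette.2 (hID ?_)⟩
    exact mem_image_of_mem _ (mem_univ x)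
  refine (card_le_card hsub).trans (card_biUnion_le.trans (sum_le_sum fun P _ => ?_))
  rw [Fintype.card_piFinset, Finset.prod_coe_sort A fun x => (palette P x).card]

/-- Distinct representatives of sets of sizes at least one, two and three. -/
lemma exists_distinct_mem {α : Type*} [DecidableEq α] {s t u : Finset α} (hs : 1 ≤ s.card)
    (ht : 2 ≤ t.card) (hu : 3 ≤ u.card) :
    ∃ i ∈ s, ∃ j ∈ t, ∃ k ∈ u, i ≠ j ∧ i ≠ k ∧ j ≠ k := by
  obtain ⟨i, hi⟩ := card_pos.1 hs
  obtain ⟨j, hj, hij⟩ := exists_mem_notMem_of_card_lt_card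
    (s := {i}) (t := t) (by rw [card_singleton]; omega)
  obtain ⟨k, hk, hijk⟩ := exists_mem_notMem_of_card_lt_card
    (s := {i, j}) (t := u) (lt_of_le_of_lt card_le_two (by omega))
  rw [mem_singleton] at hij
  simp only [mem_insert, mem_singleton, not_or] at hijk
  exact ⟨i, hi, j, hj, k, hk, fun h => hij h.symm, fun h => hijk.1 h.symm,
    fun h => hijk.2 h.symm⟩

/-- Sums whose three terms have large palettes give distinct rainbow triples. -/
lemma card_le_edgeCount {ι : Type*} {r : ℕ} {P : Finset (ℕ × Fin r)} {Q : Finset ι}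
    (x y : ι → ℕ) (hinj : ∀ a ∈ Q, ∀ b ∈ Q, x a = x b → y a = y b → a = b)
    (hx : ∀ a ∈ Q, 1 ≤ (palette P (x a)).card) (hy : ∀ a ∈ Q, 2 ≤ (palette P (y a)).card)
    (hxy : ∀ a ∈ Q, 3 ≤ (palette P (x a + y a)).card) :
    Q.card ≤ edgeCount RainbowTriple P := by
  classical
  have key : ∀ a ∈ Q, ∃ p : (ℕ × Fin r) × (ℕ × Fin r) × (ℕ × Fin r),
      p.1.1 = x a ∧ p.2.1.1 = y a ∧ p.1 ∈ P ∧ p.2.1 ∈ P ∧ p.2.2 ∈ P ∧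
        RainbowTriple p.1 p.2.1 p.2.2 := by
    intro a ha
    obtain ⟨i, hi, j, hj, k, hk, h1, h2, h3⟩ :=
      exists_distinct_mem (hx a ha) (hy a ha) (hxy a ha)
    exact ⟨((x a, i), (y a, j), (x a + y a, k)), rfl, rfl, mem_palette.1 hi, mem_palette.1 hj,
      mem_palette.1 hk, Or.inl rfl, h1, h2, h3⟩
  rcases Q.eq_empty_or_nonempty with rfl | ⟨a₀, ha₀⟩
  · exact Nat.zero_le _
  have : Nonempty ((ℕ × Fin r) × (ℕ × Fin r) × (ℕ × Fin r)) := ⟨(key a₀ ha₀).choose⟩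
  choose! p hp using key
  refine card_le_card_of_injOn p ?_ ?_
  · intro a ha
    obtain ⟨-, -, h1, h2, h3, h4⟩ := hp a ha
    exact mem_filter.2 ⟨mem_product.2 ⟨h1, mem_product.2 ⟨h2, h3⟩⟩, h4⟩
  · intro a ha b hb hab
    obtain ⟨h1, h2, -⟩ := hp a ha
    obtain ⟨h3, h4, -⟩ := hp b hb
    refine hinj a ha b hb ?_ ?_
    · rw [← h1, ← h3, hab]
    · rw [← h2, ← h4, hab]

/-- The logarithm of a product of integers between `1` and `r`, bounded by the numbers of
factors that are at least `2` and at least `3`. -/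
lemma sum_log_le {A : Finset ℕ} {r : ℕ} (hr : 2 ≤ r) {f : ℕ → ℕ} (h1 : ∀ x ∈ A, 1 ≤ f x)
    (hfr : ∀ x ∈ A, f x ≤ r) :
    ∑ x ∈ A, Real.log (f x) ≤ (A.filter (fun x => 2 ≤ f x)).card * Real.log 2 +
      (A.filter (fun x => 3 ≤ f x)).card * (Real.log r - Real.log 2) := by
  have hlog2 : 0 < Real.log 2 := Real.log_pos (by norm_num)
  have hlogr : Real.log 2 ≤ Real.log r := Real.log_le_log (by norm_num) (by exact_mod_cast hr)
  rw [← nsmul_eq_mul, ← nsmul_eq_mul, ← sum_const, ← sum_const, sum_filter, sum_filter,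
    ← sum_add_distrib]
  refine sum_le_sum fun x hx => ?_
  have hx1 := h1 x hx
  rcases lt_or_ge (f x) 2 with h2 | h2
  · obtain h : f x = 1 := by omega
    simp [h]
  · rcases lt_or_ge (f x) 3 with h3 | h3
    · obtain h : f x = 2 := by omega
      simp [h]
    · rw [if_pos h2, if_pos h3]
      have : Real.log (f x) ≤ Real.log r :=
        Real.log_le_log (by exact_mod_cast hx1) (by exact_mod_cast hfr x hx)
      linarith

/-- Sets with many rainbow sum-free colourings have a palette assignment of large weight whose
triples of large palettes are few. -/
lemma exists_palettes {r : ℕ} (hr : 1 ≤ r) {η ε : ℝ} (hη : 0 < η) (hε : 0 < ε) :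
    ∃ n₀ : ℕ, ∀ n : ℕ, n₀ ≤ n → ∀ A ⊆ Finset.Icc 1 n, 0 < numRSF r A →
      ∃ P : Finset (ℕ × Fin r), (edgeCount RainbowTriple P : ℝ) ≤ ε * n ^ 2 ∧
        (numRSF r A : ℝ) ≤ Real.exp (η * n) * ∏ x ∈ A, ((palette P x).card : ℝ) := by
  have hr0 : (0 : ℝ) < r := by exact_mod_cast hr
  have hr1 : (1 : ℝ) ≤ r := by exact_mod_cast hr
  obtain ⟨N₀, hN₀⟩ := exists_containers (3 * r) (ε / r ^ 2) (η / r) (by linarith)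
    (by positivity) (by positivity)
  refine ⟨N₀, fun n hn A hA hpos => ?_⟩
  have hAcard : A.card ≤ n := by simpa using card_le_card hA
  obtain ⟨F, hFcard, hF, hcover⟩ := hN₀ (r * n) (hn.trans (Nat.le_mul_of_pos_left n hr))
    RainbowTriple (A ×ˢ (univ : Finset (Fin r))) (fun _ _ _ h => h.swap)
    (by
      rw [card_product, card_univ, Fintype.card_fin, mul_comm]
      exact Nat.mul_le_mul_left r hAcard)
    (fun u v => by exact_mod_cast card_rainbowTriple_le _ u v)
    (fun v w => by exact_mod_cast card_rainbowTriple_left_le _ v w)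
  have hsum := numRSF_le_sum_prod_palette hcover
  have hne : F.Nonempty := by
    rw [nonempty_iff_ne_empty]
    rintro rfl
    rw [sum_empty] at hsum
    omega
  obtain ⟨P, hP, hmax⟩ := exists_max_image F (fun P => ∏ x ∈ A, (palette P x).card) hne
  refine ⟨P, ?_, ?_⟩
  · refine (hF P hP).2.trans (le_of_eq ?_)
    push_cast
    field_simp
  · have h1 : numRSF r A ≤ F.card * ∏ x ∈ A, (palette P x).card :=
      hsum.trans ((sum_le_card_nsmul _ _ _ hmax).trans (le_of_eq (smul_eq_mul _ _)))
    have h2 : (numRSF r A : ℝ) ≤ F.card * ∏ x ∈ A, ((palette P x).card : ℝ) := by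
      exact_mod_cast h1
    refine h2.trans (mul_le_mul_of_nonneg_right (hFcard.trans (le_of_eq ?_)) (by positivity))
    push_cast
    congr 1
    field_simp

theorem stmt_4 (r : ℕ) (hr : 5 ≤ r) (ε : ℝ) (hε : 0 < ε) :
    ∃ δ : ℝ, 0 < δ ∧ ∃ n₀ : ℕ, ∀ n : ℕ, n₀ ≤ n → ∀ A ⊆ Finset.Icc 1 n,
      (r : ℝ) ^ ((n : ℝ) / 2 - δ * n) ≤ (numRSF r A : ℝ) →
      ((symmDiff A ((Finset.Icc 1 n).filter (fun x => Odd x))).card : ℝ) ≤ ε * n ∨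
      ((symmDiff A (Finset.Icc (n / 2 + 1) n)).card : ℝ) ≤ ε * n := by
  obtain ⟨τ, hτ, hstruct⟩ := structure_of_weights hr hε
  obtain ⟨n₀, hn₀⟩ := exists_palettes (r := r) (by omega) (η := τ / 2) (ε := τ ^ 2)
    (by positivity) (by positivity)
  have hr0 : (0 : ℝ) < r := by exact_mod_cast (by omega : 0 < r)
  have hlogr : 0 < Real.log r := Real.log_pos (by exact_mod_cast (by omega : 1 < r))
  refine ⟨τ / (2 * Real.log r), by positivity, max n₀ ⌈1 / τ⌉₊, fun n hn A hA hg => ?_⟩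
  have hτn : 1 ≤ τ * n := by
    have h1 : 1 / τ ≤ n := (Nat.le_ceil _).trans (by exact_mod_cast (le_max_right _ _).trans hn)
    rw [div_le_iff₀ hτ] at h1
    linarith
  have hgpos : (0 : ℝ) < numRSF r A := (Real.rpow_pos_of_pos hr0 _).trans_le hg
  obtain ⟨P, hP, hprod⟩ := hn₀ n ((le_max_left _ _).trans hn) A hA (by exact_mod_cast hgpos)
  have hpal : ∀ x ∈ A, 1 ≤ (palette P x).card := by
    intro x hx
    by_contra h
    rw [prod_eq_zero hx (by exact_mod_cast (by omega : (palette P x).card = 0)), mul_zero] at hprod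
    linarith
  have hpal0 : ∀ x ∈ A, ((palette P x).card : ℝ) ≠ 0 := fun x hx => by
    have := hpal x hx
    exact_mod_cast (by omega : (palette P x).card ≠ 0)
  have hweight := sum_log_le (A := A) (r := r) (by omega) hpal fun x _ =>
    (card_le_univ _).trans (Fintype.card_fin r).le
  have hlog := Real.log_le_log (Real.rpow_pos_of_pos hr0 _) (hg.trans hprod)
  rw [Real.log_rpow hr0, Real.log_mul (Real.exp_pos _).ne' (prod_ne_zero_iff.2 hpal0),
    Real.log_exp, Real.log_prod hpal0] at hlog
  have hτlog : ((n : ℝ) / 2 - τ / (2 * Real.log r) * n) * Real.log r =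
      n / 2 * Real.log r - τ / 2 * n := by
    field_simp
  rw [hτlog] at hlog
  have hedge : ∀ k : ℕ, k ≤ edgeCount RainbowTriple P → (k : ℝ) ≤ (τ * n) ^ 2 := by
    intro k hk
    rw [mul_pow]
    exact le_trans (by exact_mod_cast hk) hP
  refine hstruct n hτn A (A.filter (fun x => 2 ≤ (palette P x).card))
    (A.filter (fun x => 3 ≤ (palette P x).card)) hA (filter_subset _ _) ?_ (by linarith) ?_ ?_
  · exact monotone_filter_right A fun x _ hx => le_trans (by norm_num) hx
  · refine hedge _ ?_
    rw [← card_sigma]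
    have hlt : ∀ p ∈ (A.filter (fun x => 3 ≤ (palette P x).card)).sigma fun c =>
        (A.filter (fun x => 2 ≤ (palette P x).card)).filter
          (fun x => c - x ∈ A.filter (fun x => 2 ≤ (palette P x).card)),
        p.2 + (p.1 - p.2) = p.1 ∧ 3 ≤ (palette P p.1).card ∧ 2 ≤ (palette P p.2).card ∧
          2 ≤ (palette P (p.1 - p.2)).card := by
      rintro ⟨c, x⟩ hp
      simp only [mem_sigma, mem_filter] at hp ⊢
      have := mem_Icc.1 (hA hp.2.2.1)
      exact ⟨by omega, hp.1.2, hp.2.1.2, hp.2.2.2⟩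
    refine card_le_edgeCount (fun p => p.2) (fun p => p.1 - p.2) ?_
      (fun p hp => le_trans (by norm_num) (hlt p hp).2.2.1) (fun p hp => (hlt p hp).2.2.2) ?_
    · rintro ⟨c, x⟩ hp ⟨d, y⟩ hq h1 h2
      have h3 := (hlt _ hp).1
      have h4 := (hlt _ hq).1
      simp only at h1 h2 h3 h4
      obtain rfl : c = d := by omega
      rw [h1]
    · intro p hp
      rw [(hlt p hp).1]
      exact (hlt p hp).2.1
  · refine hedge _ ?_
    rw [← card_sigma]
    have hmem : ∀ p ∈ A.sigma fun a => (A.filter (fun x => 3 ≤ (palette P x).card)).filter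
          (fun x => x + a ∈ A.filter (fun x => 3 ≤ (palette P x).card)),
        p.1 ∈ A ∧ 3 ≤ (palette P p.2).card ∧ 3 ≤ (palette P (p.2 + p.1)).card := by
      rintro ⟨a, x⟩ hp
      simp only [mem_sigma, mem_filter] at hp ⊢
      exact ⟨hp.1, hp.2.1.2, hp.2.2.2⟩
    refine card_le_edgeCount (fun p => p.1) (fun p => p.2) ?_
      (fun p hp => hpal _ (hmem p hp).1) (fun p hp => le_trans (by norm_num) (hmem p hp).2.1) ?_
    · rintro ⟨a, x⟩ _ ⟨b, y⟩ _ h1 h2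
      simp only at h1 h2
      rw [h1, h2]
    · intro p hp
      rw [add_comm]
      exact (hmem p hp).2.2
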